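/- arXiv:1903.01315 — 2 statements merged into one kernel-verified Lean document; each statement's English description precedes it below -/
import Mathlib

section
/- Let D_0 ⊆ D_1 ⊆ ... ⊆ D_t = M be the dimension filtration of M and let x ∈ b(M)^3 be a parameter element of M. Then M is sequentially Cohen-Macaulay if and only if M/xM is sequentially Cohen-Macaulay and M/D_{t-1} is Cohen-Macaulay. -/
open IsLocalRing

universe u

namespace Paper

variable (R : Type u) [CommRing R]

/-- `dim_{R/I} Soc_I(N)` where `Soc_I(N) = (0 :_N I)`. -/
noncomputable def socDim (I : Ideal R) (N : Type u) [AddCommGroup N] [Module R N] : ℕ :=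
  Module.finrank (R ⧸ I) (Submodule.torsionBySet R N (I : Set R))

/-- Krull dimension of a module (`⊥` for the zero module). -/
noncomputable def mdim (M : Type u) [AddCommGroup M] [Module R M] : WithBot (WithTop ℕ) :=
  ringKrullDim (R ⧸ Module.annihilator R M)

/-- The index of reducibility of an ideal `q` on `M`: `dim_k Soc (M/qM)`. -/
noncomputable def ir [IsLocalRing R] (M : Type u) [AddCommGroup M] [Module R M]
    (q : Ideal R) : ℕ :=
  socDim R (maximalIdeal R) (M ⧸ (q • ⊤ : Submodule R M))

/-- `dim_k Soc (H^i_m(M))`. -/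
noncomputable def socH [IsLocalRing R] (M : Type u) [AddCommGroup M] [Module R M] (i : ℕ) : ℕ :=
  socDim R (maximalIdeal R) ((localCohomology (maximalIdeal R) i).obj (ModuleCat.of R M))

/-- A system of parameters of `M` (of length `d`): `d` elements of the maximal ideal such
that the quotient has finite length. -/
def IsSOP [IsLocalRing R] (M : Type u) [AddCommGroup M] [Module R M] (d : ℕ)
    (x : Fin d → R) : Prop :=
  (∀ i, x i ∈ maximalIdeal R) ∧
    IsFiniteLength R (M ⧸ (Ideal.span (Set.range x) • ⊤ : Submodule R M))

/-- A parameter element: an element occurring in some system of parameters of `M`. -/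
def IsParamElement [IsLocalRing R] (M : Type u) [AddCommGroup M] [Module R M] (d : ℕ)
    (a : R) : Prop :=
  ∃ x : Fin d → R, IsSOP R M d x ∧ ∃ i, x i = a

/-- The ideal `b(M) = ⋂ Ann (0 :_{M/(x_1,...,x_{i-1})M} x_i)`, the intersection running over
all systems of parameters `x_1, ..., x_d` of `M`. -/
noncomputable def bIdeal [IsLocalRing R] (M : Type u) [AddCommGroup M] [Module R M]
    (d : ℕ) : Ideal R :=
  ⨅ (x : Fin d → R) (_ : IsSOP R M d x) (i : Fin d),
    Module.annihilator R
      (Submodule.torsionBy R (M ⧸ (Ideal.span (x '' {j | j < i}) • ⊤ : Submodule R M)) (x i))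

/-- A C-system of parameters: `x_i ∈ b(M/(x_{i+1},...,x_d)M)^3` for all `i`. -/
def IsCSOP [IsLocalRing R] (M : Type u) [AddCommGroup M] [Module R M] (d : ℕ)
    (x : Fin d → R) : Prop :=
  IsSOP R M d x ∧ ∀ i : Fin d,
    x i ∈ (bIdeal R (M ⧸ (Ideal.span (x '' {j | i < j}) • ⊤ : Submodule R M)) ((i : ℕ) + 1)) ^ 3

/-- The depth of `M`: the supremum of the lengths of `M`-regular sequences contained in the
maximal ideal. -/
noncomputable def depth [IsLocalRing R] (M : Type u) [AddCommGroup M] [Module R M] :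
    WithTop ℕ :=
  sSup {n : WithTop ℕ | ∃ rs : List R, (rs.length : WithTop ℕ) = n ∧
    (∀ r ∈ rs, r ∈ maximalIdeal R) ∧ RingTheory.Sequence.IsRegular M rs}

/-- `M` is a Cohen-Macaulay module: `depth M = dim M`. -/
def IsCM [IsLocalRing R] (M : Type u) [AddCommGroup M] [Module R M] : Prop :=
  (depth R M : WithBot (WithTop ℕ)) = mdim R M

/-- A Cohen-Macaulay local ring. -/
def IsCMLocalRing (S : Type u) [CommRing S] [IsLocalRing S] : Prop :=
  IsNoetherianRing S ∧ IsCM S S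

/-- `R` is a homomorphic image of a Cohen-Macaulay (Noetherian) local ring. -/
def IsQuotientOfCMLocalRing : Prop :=
  ∃ (S : Type u) (_ : CommRing S) (_ : IsLocalRing S),
    IsCMLocalRing S ∧ ∃ f : S →+* R, Function.Surjective f

/-- The largest submodule of (the submodule) `N` whose dimension is strictly smaller than
that of `N`. -/
noncomputable def uComp (M : Type u) [AddCommGroup M] [Module R M] (N : Submodule R M) :
    Submodule R M :=
  sSup {P : Submodule R M | P ≤ N ∧ mdim R P < mdim R N}

/-- The unmixed component `U_M(0)` of `M`: the largest submodule of dimension `< dim M`. -/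
noncomputable def unmixedComp (M : Type u) [AddCommGroup M] [Module R M] : Submodule R M :=
  uComp R M ⊤

/-- The 0-th local cohomology `H^0_m(M)` realized as the submodule of elements annihilated by
some power of the maximal ideal. -/
def H0sub [IsLocalRing R] (M : Type u) [AddCommGroup M] [Module R M] : Submodule R M :=
  ⨆ n : ℕ, Submodule.torsionBySet R M (((maximalIdeal R) ^ n : Ideal R) : Set R)

/-- The quotient `P/N` of two submodules of `M`. -/
abbrev subQuot (M : Type u) [AddCommGroup M] [Module R M] (P N : Submodule R M) :=
  P ⧸ (Submodule.comap P.subtype N)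

/-- `D_0 ⊆ D_1 ⊆ ⋯ ⊆ D_t = M` is the dimension filtration of `M`:
`D_t = M`, each `D_{i-1}` is the largest submodule of `D_i` of strictly smaller dimension,
and `D_0 = H^0_m(M)`. -/
def IsDimFiltration [IsLocalRing R] (M : Type u) [AddCommGroup M] [Module R M]
    (t : ℕ) (D : Fin (t + 1) → Submodule R M) : Prop :=
  D (Fin.last t) = ⊤ ∧ (∀ i : Fin t, D i.castSucc = uComp R M (D i.succ)) ∧
    D 0 = H0sub R M

/-- `M` is sequentially Cohen-Macaulay: all quotients `D_i/D_{i-1}` of the dimension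
filtration are Cohen-Macaulay. -/
def IsSeqCM [IsLocalRing R] (M : Type u) [AddCommGroup M] [Module R M] : Prop :=
  ∃ (t : ℕ) (D : Fin (t + 1) → Submodule R M), IsDimFiltration R M t D ∧
    ∀ i : Fin t, IsCM R (subQuot R M (D i.succ) (D i.castSucc))

/-- `M` (of dimension `d`) is generalized Cohen-Macaulay: `H^i_m(M)` has finite length
for all `i < d`. -/
def IsGenCM [IsLocalRing R] (M : Type u) [AddCommGroup M] [Module R M] (d : ℕ) : Prop :=
  ∀ i < d, IsFiniteLength R ((localCohomology (maximalIdeal R) i).obj (ModuleCat.of R M))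

/-- `α_n(M)`: the minimum of the indices of reducibility of parameter ideals of `M`
contained in `m^n`. -/
noncomputable def alphaN [IsLocalRing R] (M : Type u) [AddCommGroup M] [Module R M]
    (d n : ℕ) : ℕ :=
  sInf {r : ℕ | ∃ x : Fin d → R, IsSOP R M d x ∧
    Ideal.span (Set.range x) ≤ (maximalIdeal R) ^ n ∧ r = ir R M (Ideal.span (Set.range x))}

/-- The limit value `α(M) = lim_n α_n(M)` (the supremum of the non-decreasing sequence). -/
noncomputable def alphaLim [IsLocalRing R] (M : Type u) [AddCommGroup M] [Module R M]
    (d : ℕ) : ℕ :=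
  ⨆ n : ℕ, alphaN R M d (n + 1)

/-- `M` is unmixed: `dim R/p = dim M` for all associated primes `p`. -/
def IsUnmixed (M : Type u) [AddCommGroup M] [Module R M] : Prop :=
  ∀ p ∈ associatedPrimes R M, ringKrullDim (R ⧸ p) = mdim R M

/-- Serre's condition `(S_2)` for a module. -/
def IsS2 (L : Type u) [AddCommGroup L] [Module R L] : Prop :=
  ∀ p : PrimeSpectrum R, p ∈ Module.support R L →
    min 2 (mdim (Localization.AtPrime p.asIdeal) (LocalizedModule p.asIdeal.primeCompl L)) ≤
      (depth (Localization.AtPrime p.asIdeal) (LocalizedModule p.asIdeal.primeCompl L) :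
        WithBot (WithTop ℕ))

/-- `ι : M →ₗ[R] S` exhibits `S` as an `S_2`-ification of `M`. -/
def IsS2ification [IsLocalRing R] (M S : Type u) [AddCommGroup M] [Module R M]
    [AddCommGroup S] [Module R S] (ι : M →ₗ[R] S) : Prop :=
  Function.Injective ι ∧ Module.Finite R S ∧ IsS2 R S ∧
    ∀ (p : Ideal R) [p.IsPrime], p ≠ maximalIdeal R →
      IsS2 (Localization.AtPrime p) (LocalizedModule p.primeCompl M) →
      Function.Surjective (IsLocalizedModule.map p.primeCompl
        (LocalizedModule.mkLinearMap p.primeCompl M)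
        (LocalizedModule.mkLinearMap p.primeCompl S) ι)

end Paper

open Paper IsLocalRing

set_option linter.unusedSectionVars false
set_option linter.unusedVariables false
namespace SCM
universe v
open Module CategoryTheory Abelian
section
variable {R : Type u} [CommRing R]

lemma mdim_eq (M : Type u) [AddCommGroup M] [Module R M] [Module.Finite R M] :
    mdim R M = supportDim R M :=
  (supportDim_eq_ringKrullDim_quotient_annihilator R M).symm

lemma mdim_lt_iff (M N : Type u) [AddCommGroup M] [Module R M] [Module.Finite R M]
    [AddCommGroup N] [Module R N] [Module.Finite R N] :
    mdim R M < mdim R N ↔ supportDim R M < supportDim R N := by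
  rw [mdim_eq, mdim_eq]; exact Iff.rfl

lemma mdim_eq_nat_iff (M : Type u) [AddCommGroup M] [Module R M] [Module.Finite R M] (n : ℕ) :
    mdim R M = (n : WithBot (WithTop ℕ)) ↔ supportDim R M = (n : WithBot ℕ∞) := by
  rw [mdim_eq]; exact Iff.rfl

/-- dimension of an extension -/
lemma sdim_of_exact {A B C : Type u} [AddCommGroup A] [Module R A] [AddCommGroup B] [Module R B]
    [AddCommGroup C] [Module R C] {f : A →ₗ[R] B} {g : B →ₗ[R] C} (h : Function.Exact f g)
    (hf : Function.Injective f) (hg : Function.Surjective g) {c : WithBot ℕ∞}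
    (hA : supportDim R A ≤ c) (hC : supportDim R C ≤ c) : supportDim R B ≤ c := by
  refine iSup_le fun p => ?_
  have key : ∀ (X : Type u) [AddCommGroup X] [Module R X], supportDim R X ≤ c →
      p.head.1 ∈ support R X → (p.length : WithBot ℕ∞) ≤ c := by
    intro X _ _ hX hp
    refine le_trans ?_ hX
    have hmem : ∀ i, (p i).1 ∈ support R X := fun i =>
      mem_support_mono (p.head_le i) hp
    exact le_iSup (fun p : LTSeries (support R X) => (p.length : WithBot ℕ∞))
      ⟨p.length, fun i => ⟨(p i).1, hmem i⟩, fun i => p.step i⟩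
  rcases (Module.support_of_exact h hf hg).le p.head.2 with h | h
  · exact key A hA h
  · exact key C hC h

lemma sdim_quot {B : Type u} [AddCommGroup B] [Module R B] (N : Submodule R B) {c : WithBot ℕ∞}
    (hA : supportDim R N ≤ c) (hC : supportDim R (B ⧸ N) ≤ c) : supportDim R B ≤ c :=
  sdim_of_exact (f := N.subtype) (g := N.mkQ)
    (LinearMap.exact_subtype_mkQ N) N.subtype_injective N.mkQ_surjective hA hC

lemma sdim_sup {B : Type u} [AddCommGroup B] [Module R B] (N P : Submodule R B) {c : WithBot ℕ∞}
    (hA : supportDim R N ≤ c) (hC : supportDim R P ≤ c) :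
    supportDim R (N ⊔ P : Submodule R B) ≤ c := by
  have e := LinearMap.quotientInfEquivSupQuotient P N
  have : supportDim R (↥(P ⊔ N) ⧸ Submodule.comap (P ⊔ N).subtype N) ≤ c := by
    rw [← supportDim_eq_of_equiv e]
    exact (supportDim_le_of_surjective _ (Submodule.mkQ_surjective _)).trans hC
  have h2 : supportDim R (Submodule.comap (P ⊔ N).subtype N) ≤ c := by
    rw [supportDim_eq_of_equiv (Submodule.comapSubtypeEquivOfLe le_sup_right)]
    exact hA
  rw [sup_comm]
  exact sdim_quot _ h2 this

lemma sdim_mono {B : Type u} [AddCommGroup B] [Module R B] {N P : Submodule R B} (h : N ≤ P) :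
    supportDim R N ≤ supportDim R P :=
  supportDim_le_of_injective (Submodule.inclusion h) (Submodule.inclusion_injective h)

variable [IsLocalRing R]

/-- vanishing of Ext against the residue field -/
def EV (R : Type u) [CommRing R] [IsLocalRing R] (n : ℕ) (M : Type u) [AddCommGroup M]
    [Module R M] : Prop :=
  ∀ i < n, Subsingleton (Ext (ModuleCat.of R (Shrink.{u} (R ⧸ maximalIdeal R)))
    (ModuleCat.of R M) i)

lemma EV.mono {n m : ℕ} (h : m ≤ n) {M : Type u} [AddCommGroup M] [Module R M] (hM : EV R n M) :
    EV R m M := fun i hi => hM i (hi.trans_le h)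

lemma EV.congr {n : ℕ} {M N : Type u} [AddCommGroup M] [Module R M] [AddCommGroup N] [Module R N]
    (e : M ≃ₗ[R] N) (hM : EV R n M) : EV R n N := fun i hi => by
  have := hM i hi
  refine ⟨fun a b => ?_⟩
  have key : ∀ a : Ext (ModuleCat.of R (Shrink.{u} (R ⧸ maximalIdeal R))) (ModuleCat.of R N) i,
      a = 0 := by
    intro a
    have h1 : (a.comp (Ext.mk₀ e.toModuleIso.inv) (add_zero i)).comp
        (Ext.mk₀ e.toModuleIso.hom) (add_zero i) = a := by
      rw [Ext.comp_assoc_of_third_deg_zero, Ext.mk₀_comp_mk₀, Iso.inv_hom_id, Ext.comp_mk₀_id]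
    rw [← h1, Subsingleton.elim (a.comp (Ext.mk₀ e.toModuleIso.inv) (add_zero i)) 0]
    simp
  rw [key a, key b]

section ses
variable {A B C : Type u} [AddCommGroup A] [Module R A] [AddCommGroup B] [Module R B]
    [AddCommGroup C] [Module R C] {f : A →ₗ[R] B} {g : B →ₗ[R] C}

lemma ses (h : Function.Exact f g)
    (hf : Function.Injective f) (hg : Function.Surjective g) :
    (ShortComplex.mk (ModuleCat.ofHom f) (ModuleCat.ofHom g)
      (by ext x; simpa using h.apply_apply_eq_zero x)).ShortExact where
  exact := ModuleCat.shortComplex_exact _ h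
  mono_f := (ModuleCat.mono_iff_injective _).mpr hf
  epi_g := (ModuleCat.epi_iff_surjective _).mpr hg

lemma EV.mid (h : Function.Exact f g)
    (hf : Function.Injective f) (hg : Function.Surjective g) {n : ℕ} (hA : EV R n A)
    (hC : EV R n C) : EV R n B := fun i hi => by
  have zero1 := AddCommGrpCat.isZero_of_iff_subsingleton.mpr (hA i hi)
  have zero2 := AddCommGrpCat.isZero_of_iff_subsingleton.mpr (hC i hi)
  exact AddCommGrpCat.subsingleton_of_isZero <| ShortComplex.Exact.isZero_of_both_zeros
        ((Ext.covariant_sequence_exact₂' (ModuleCat.of R (Shrink.{u} (R ⧸ maximalIdeal R)))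
          (ses h hf hg)) i)
        (zero1.eq_zero_of_src _) (zero2.eq_zero_of_tgt _)

lemma EV.right (h : Function.Exact f g)
    (hf : Function.Injective f) (hg : Function.Surjective g) {n : ℕ} (hA : EV R (n+1) A)
    (hB : EV R n B) : EV R n C := fun i hi => by
  have zero1 := AddCommGrpCat.isZero_of_iff_subsingleton.mpr (hB i hi)
  have zero2 := AddCommGrpCat.isZero_of_iff_subsingleton.mpr (hA (i+1) (by omega))
  exact AddCommGrpCat.subsingleton_of_isZero <| ShortComplex.Exact.isZero_of_both_zeros
        ((Ext.covariant_sequence_exact₃' (ModuleCat.of R (Shrink.{u} (R ⧸ maximalIdeal R)))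
          (ses h hf hg)) i (i+1) rfl)
        (zero1.eq_zero_of_src _) (zero2.eq_zero_of_tgt _)

variable [IsNoetherianRing R]

lemma smul_top_lt (M : Type u) [AddCommGroup M] [Module R M] [Module.Finite R M] [Nontrivial M] :
    maximalIdeal R • (⊤ : Submodule R M) < ⊤ := by
  refine lt_top_iff_ne_top.mpr fun h => ?_
  exact top_ne_bot (Submodule.eq_bot_of_le_smul_of_le_jacobson_bot (maximalIdeal R)
    (⊤ : Submodule R M) (Module.Finite.fg_top) h.ge
      (by rw [jacobson_eq_maximalIdeal _ bot_ne_top]))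

lemma EV_iff (n : ℕ) (M : Type u) [AddCommGroup M] [Module R M] [Module.Finite R M]
    [Nontrivial M] : EV R n M ↔ ∃ rs : List R, rs.length = n ∧ (∀ r ∈ rs, r ∈ maximalIdeal R) ∧
      RingTheory.Sequence.IsRegular M rs :=
  (ModuleCat.exists_isRegular_tfae (maximalIdeal R) n (ModuleCat.of R M) (smul_top_lt M)).out 1 3

lemma EV_zero (M : Type u) [AddCommGroup M] [Module R M] : EV R 0 M := fun i hi => by omega

/-- left term -/
lemma EV.left (h : Function.Exact f g)
    (hf : Function.Injective f) (hg : Function.Surjective g) {n : ℕ} (hB : EV R n B)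
    (hC : EV R n C) : EV R n A := fun i hi => by
  cases i with
  | zero =>
    have h0 := hB 0 hi
    have : Subsingleton (ModuleCat.of R (Shrink.{u} (R ⧸ maximalIdeal R)) ⟶ ModuleCat.of R B) :=
      Ext.addEquiv₀.subsingleton_congr.mp h0
    refine Ext.addEquiv₀.subsingleton_congr.mpr ⟨fun a b => ?_⟩
    have : Mono (ModuleCat.ofHom f) := (ModuleCat.mono_iff_injective _).mpr hf
    rw [← cancel_mono (ModuleCat.ofHom f)]
    exact Subsingleton.elim _ _
  | succ i =>
    have zero1 := AddCommGrpCat.isZero_of_iff_subsingleton.mpr (hC i (by omega))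
    have zero2 := AddCommGrpCat.isZero_of_iff_subsingleton.mpr (hB (i+1) (by omega))
    exact AddCommGrpCat.subsingleton_of_isZero <| ShortComplex.Exact.isZero_of_both_zeros
        ((Ext.covariant_sequence_exact₁' (ModuleCat.of R (Shrink.{u} (R ⧸ maximalIdeal R)))
          (ses h hf hg)) i (i+1) rfl)
        (zero1.eq_zero_of_src _) (zero2.eq_zero_of_tgt _)

lemma EV.quotSMulTop {M : Type u} [AddCommGroup M] [Module R M] {x : R} (hx : IsSMulRegular M x)
    {n : ℕ} (h : EV R (n+1) M) : EV R n (QuotSMulTop x M) :=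
  EV.right (LinearMap.exact_lsmul_mkQ_smul_top M x) (fun a b hab => hx hab)
    (Submodule.mkQ_surjective _) h (h.mono (by omega))

lemma length_le {M : Type u} [AddCommGroup M] [Module R M] [Module.Finite R M] [Nontrivial M]
    {rs : List R} (hm : ∀ r ∈ rs, r ∈ maximalIdeal R) (h : RingTheory.Sequence.IsRegular M rs) :
    (rs.length : WithBot ℕ∞) ≤ supportDim R M := by
  rw [← supportDim_add_length_eq_supportDim_of_isRegular rs h]
  have : Nontrivial (M ⧸ (Ideal.ofList rs • ⊤ : Submodule R M)) :=
    Submodule.Quotient.nontrivial_iff.mpr h.top_ne_smul.symm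
  have h0 := supportDim_ne_bot_of_nontrivial R (M ⧸ (Ideal.ofList rs • ⊤ : Submodule R M))
  obtain ⟨k, hk⟩ := WithBot.ne_bot_iff_exists.mp h0
  rw [← hk]
  norm_cast
  exact le_add_self

lemma isCM_iff {M : Type u} [AddCommGroup M] [Module R M] [Module.Finite R M] [Nontrivial M]
    {n : ℕ} (hn : supportDim R M = n) : IsCM R M ↔ EV R n M := by
  unfold IsCM
  rw [(mdim_eq_nat_iff M n).mpr hn, EV_iff]
  have hne : {n : WithTop ℕ | ∃ rs : List R, (rs.length : WithTop ℕ) = n ∧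
    (∀ r ∈ rs, r ∈ maximalIdeal R) ∧ RingTheory.Sequence.IsRegular M rs}.Nonempty :=
    ⟨0, [], by simp, by simp, RingTheory.Sequence.IsRegular.nil R M⟩
  have hub : ∀ k : ℕ, (∃ rs : List R, rs.length = k ∧
    (∀ r ∈ rs, r ∈ maximalIdeal R) ∧ RingTheory.Sequence.IsRegular M rs) → k ≤ n := by
    rintro k ⟨rs, rfl, h1, h2⟩
    have := length_le h1 h2
    rw [hn] at this
    exact_mod_cast this
  constructor
  · intro h
    have hd : depth R M = (n : WithTop ℕ) := by
      exact WithBot.coe_injective h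
    have hb : depth R M < ⊤ := by rw [hd]; exact WithTop.coe_lt_top n
    obtain ⟨rs, h1, h2, h3⟩ := @ENat.sSup_mem_of_nonempty_of_lt_top
      {n : WithTop ℕ | ∃ rs : List R, (rs.length : WithTop ℕ) = n ∧
      (∀ r ∈ rs, r ∈ maximalIdeal R) ∧ RingTheory.Sequence.IsRegular M rs} hne.to_subtype hb
    change (rs.length : WithTop ℕ) = depth R M at h1
    exact ⟨rs, by rw [hd] at h1; exact_mod_cast h1, h2, h3⟩
  · rintro ⟨rs, h1, h2, h3⟩
    have hd : depth R M = (n : WithTop ℕ) := by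
      apply le_antisymm
      · apply sSup_le
        rintro _ ⟨rs, rfl, h⟩
        exact_mod_cast hub _ ⟨rs, rfl, h⟩
      · exact le_sSup ⟨rs, by rw [h1], h2, h3⟩
    rw [hd]; rfl

lemma not_isCM_of_subsingleton {M : Type u} [AddCommGroup M] [Module R M] [Module.Finite R M]
    [Subsingleton M] : ¬ IsCM R M := by
  unfold IsCM
  rw [mdim_eq, supportDim_eq_bot_of_subsingleton]
  exact WithBot.coe_ne_bot

end ses
end
end SCM

set_option linter.unusedSectionVars false
set_option linter.unusedVariables false
namespace SCM
open Module CategoryTheory Abelian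
section
variable {R : Type u} [CommRing R] [IsLocalRing R] [IsNoetherianRing R]

lemma sdim_succ_of_regular {N : Type u} [AddCommGroup N] [Module R N] [Module.Finite R N]
    {x : R} (hx : IsSMulRegular N x) (hm : x ∈ maximalIdeal R) {n : ℕ}
    (h : (n : WithBot ℕ∞) ≤ supportDim R (QuotSMulTop x N)) :
    ((n + 1 : ℕ) : WithBot ℕ∞) ≤ supportDim R N := by
  rw [← supportDim_quotSMulTop_succ_eq_supportDim hx hm]
  push_cast
  gcongr

lemma exists_regular {M : Type u} [AddCommGroup M] [Module R M] [Module.Finite R M] [Nontrivial M]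
    {n : ℕ} (h : EV R (n+1) M) : ∃ x ∈ maximalIdeal R, IsSMulRegular M x := by
  obtain ⟨rs, h1, h2, h3⟩ := (EV_iff _ _).mp h
  match rs, h1 with
  | r :: rs, _ =>
    exact ⟨r, h2 r (by simp), ((RingTheory.Sequence.isRegular_cons_iff M r rs).mp h3).1⟩

theorem unmixed (n : ℕ) : ∀ (M : Type u) [AddCommGroup M] [Module R M] [Module.Finite R M],
    EV R n M → ∀ N : Submodule R M, N ≠ ⊥ → (n : WithBot ℕ∞) ≤ supportDim R N := by
  induction n with
  | zero =>
    intro M _ _ _ _ N hN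
    have : Nontrivial N := (Submodule.nontrivial_iff_ne_bot).mpr hN
    obtain ⟨k, hk⟩ := WithBot.ne_bot_iff_exists.mp (supportDim_ne_bot_of_nontrivial R N)
    rw [← hk]
    exact_mod_cast zero_le
  | succ n ih =>
    intro M _ _ _ hM N hN
    by_contra hlt
    rw [not_le] at hlt
    have wf : WellFoundedGT (Submodule R M) := inferInstance
    obtain ⟨K, ⟨hK0, hKd⟩, hmax⟩ := wf.wf.has_min
      {K : Submodule R M | K ≠ ⊥ ∧ supportDim R K < ((n+1 : ℕ) : WithBot ℕ∞)} ⟨N, hN, hlt⟩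
    have ntK : Nontrivial K := (Submodule.nontrivial_iff_ne_bot).mpr hK0
    have : Nontrivial M := K.subtype_injective.nontrivial
    obtain ⟨x, hxm, hx⟩ := exists_regular hM
    have hKle : K ≤ K.comap (LinearMap.lsmul R M x) := fun m hm => K.smul_mem x hm
    have heq : K = K.comap (LinearMap.lsmul R M x) := by
      by_contra hne
      refine hmax _ ⟨?_, ?_⟩ (lt_of_le_of_ne hKle hne)
      · intro h; exact hK0 (le_bot_iff.mp (hKle.trans h.le))
      · refine lt_of_le_of_lt ?_ hKd
        refine supportDim_le_of_injective
          (((LinearMap.lsmul R M x).comp (K.comap (LinearMap.lsmul R M x)).subtype).codRestrict K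
            (fun c => c.2)) ?_
        intro a b hab
        have h1 := congrArg Subtype.val hab
        exact Subtype.ext (hx h1)
    have hxK : IsSMulRegular K x := fun a b hab => Subtype.ext (hx (congrArg Subtype.val hab))
    refine absurd (sdim_succ_of_regular (n := n) hxK hxm ?_) (not_le.mpr hKd)
    have hinj : Function.Injective (QuotSMulTop.map x K.subtype) := by
      rw [← LinearMap.ker_eq_bot, LinearMap.ker_eq_bot']
      intro q hq
      obtain ⟨k, rfl⟩ := Submodule.Quotient.mk_surjective _ q
      rw [QuotSMulTop.map_apply_mk, Submodule.Quotient.mk_eq_zero,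
        Submodule.mem_smul_pointwise_iff_exists] at hq
      obtain ⟨m, -, hm⟩ := hq
      have hmK : m ∈ K := by
        rw [heq]
        change x • m ∈ K
        rw [hm]; exact k.2
      rw [Submodule.Quotient.mk_eq_zero, Submodule.mem_smul_pointwise_iff_exists]
      exact ⟨⟨m, hmK⟩, trivial, Subtype.ext hm⟩
    have hnt : Nontrivial (QuotSMulTop x K) := by
      refine Submodule.Quotient.nontrivial_iff.mpr (ne_of_lt (lt_of_le_of_lt ?_ (smul_top_lt K)))
      rw [← Submodule.ideal_span_singleton_smul]
      exact Submodule.smul_mono_left ((Ideal.span_singleton_le_iff_mem _).mpr hxm)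
    have h2 := ih (QuotSMulTop x M) (hM.quotSMulTop hx) (LinearMap.range (QuotSMulTop.map x K.subtype)) (by
      intro h
      obtain ⟨a, ha⟩ := exists_ne (0 : QuotSMulTop x K)
      apply ha
      apply hinj
      rw [map_zero, LinearMap.range_eq_bot.mp h, LinearMap.zero_apply])
    rwa [← supportDim_eq_of_equiv (LinearEquiv.ofInjective _ hinj)] at h2

section ucomp
variable {M : Type u} [AddCommGroup M] [Module R M] [Module.Finite R M]

lemma uComp_eq (N : Submodule R M) :
    uComp R M N = sSup {P : Submodule R M | P ≤ N ∧ supportDim R P < supportDim R N} := by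
  unfold uComp
  congr 1
  ext P
  simp only [Set.mem_ofPred_eq, mdim_lt_iff]

lemma uComp_le (N : Submodule R M) : uComp R M N ≤ N := sSup_le fun _ h => h.1

lemma uComp_bot : uComp R M ⊥ = ⊥ := le_bot_iff.mp (uComp_le _)

lemma le_uComp {N P : Submodule R M} (h : P ≤ N) (hd : supportDim R P < supportDim R N) :
    P ≤ uComp R M N := by
  rw [uComp_eq]; exact le_sSup ⟨h, hd⟩

lemma sdim_uComp {N : Submodule R M} (hN : N ≠ ⊥) :
    supportDim R (uComp R M N) < supportDim R N := by
  have : Nontrivial N := (Submodule.nontrivial_iff_ne_bot).mpr hN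
  rw [uComp_eq]
  have key := CompleteLattice.WellFoundedGT.isSupClosedCompact (Submodule R M) inferInstance
    {P : Submodule R M | P ≤ N ∧ supportDim R P < supportDim R N} ?_ ?_
  · exact key.2
  · refine ⟨⊥, bot_le, ?_⟩
    rw [supportDim_eq_bot_of_subsingleton]
    exact bot_lt_iff_ne_bot.mpr (supportDim_ne_bot_of_nontrivial R N)
  · rintro P ⟨h1, h2⟩ Q ⟨h3, h4⟩
    exact ⟨sup_le h1 h3, lt_of_le_of_lt (sdim_sup P Q (le_max_left _ _) (le_max_right _ _))
      (max_lt h2 h4)⟩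

/-- If `M/W` has depth at least `n`, submodules of dimension `< n` lie in `W`. -/
lemma le_of_sdim_lt {W P : Submodule R M} {n : ℕ} (hW : EV R n (M ⧸ W))
    (hP : supportDim R P < (n : WithBot ℕ∞)) : P ≤ W := by
  by_contra h
  have h1 : P.map W.mkQ ≠ ⊥ := by
    intro h2
    rw [← LinearMap.le_ker_iff_map, Submodule.ker_mkQ] at h2
    exact h h2
  have h2 := unmixed n _ hW _ h1
  refine absurd (h2.trans ?_) (not_le.mpr hP)
  exact supportDim_le_of_surjective (W.mkQ.submoduleMap P) (W.mkQ.submoduleMap_surjective P)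

inductive SC (R : Type u) [CommRing R] [IsLocalRing R] (M : Type u) [AddCommGroup M] [Module R M] :
    Submodule R M → Prop
  | base : SC R M (H0sub R M)
  | step (N : Submodule R M) : IsCM R (subQuot R M N (uComp R M N)) → SC R M (uComp R M N) →
      SC R M N

lemma isSeqCM_iff : IsSeqCM R M ↔ SC R M ⊤ := by
  constructor
  · rintro ⟨t, D, ⟨h1, h2, h3⟩, h4⟩
    rw [← h1]
    have : ∀ i : Fin (t+1), SC R M (D i) := by
      intro i
      induction i using Fin.induction with
      | zero => rw [h3]; exact SC.base
      | succ i ih =>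
        refine SC.step _ ?_ ?_
        · rw [← h2 i]; exact h4 i
        · rw [← h2 i]; exact ih
    exact this _
  · intro h
    have : ∀ N, SC R M N → ∃ (t : ℕ) (D : Fin (t + 1) → Submodule R M),
        (D (Fin.last t) = N ∧ (∀ i : Fin t, D i.castSucc = uComp R M (D i.succ)) ∧
          D 0 = H0sub R M) ∧ ∀ i : Fin t, IsCM R (subQuot R M (D i.succ) (D i.castSucc)) := by
      intro N hN
      induction hN with
      | base => exact ⟨0, fun _ => H0sub R M, ⟨rfl, fun i => i.elim0, rfl⟩, fun i => i.elim0⟩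
      | step N hc _ ih =>
        obtain ⟨t, D, ⟨h1, h2, h3⟩, h4⟩ := ih
        refine ⟨t+1, Fin.snoc (α := fun _ => Submodule R M) D N, ⟨by simp, ?_, ?_⟩, ?_⟩
        · intro i
          induction i using Fin.lastCases with
          | last => simp [h1]
          | cast i => rw [← Fin.castSucc_succ, Fin.snoc_castSucc, Fin.snoc_castSucc]; exact h2 i
        · rw [← Fin.castSucc_zero, Fin.snoc_castSucc]; exact h3
        · intro i
          induction i using Fin.lastCases with
          | last => rw [Fin.succ_last, Fin.snoc_last, Fin.snoc_castSucc, h1]; exact hc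
          | cast i => rw [← Fin.castSucc_succ, Fin.snoc_castSucc, Fin.snoc_castSucc]; exact h4 i
    exact this _ h
end ucomp
end
end SCM

set_option linter.unusedSectionVars false
set_option linter.unusedVariables false
namespace SCM
open Module CategoryTheory Abelian
section
variable {R : Type u} [CommRing R] [IsLocalRing R] [IsNoetherianRing R]

section zero
variable {M : Type u} [AddCommGroup M] [Module R M] [Module.Finite R M]

lemma sdim_le_zero_iff : supportDim R M ≤ 0 ↔ ∃ n, maximalIdeal R ^ n ≤ annihilator R M := by
  constructor
  · intro h
    have hrad : maximalIdeal R ≤ (annihilator R M).radical := by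
      rw [← PrimeSpectrum.zeroLocus_subset_zeroLocus_iff, ← support_eq_zeroLocus]
      rcases subsingleton_or_nontrivial M with h0 | h0
      · rw [support_eq_empty]; exact Set.empty_subset _
      · have h1 : supportDim R M = 0 := by
          apply le_antisymm h
          obtain ⟨k, hk⟩ := WithBot.ne_bot_iff_exists.mp (supportDim_ne_bot_of_nontrivial R M)
          rw [← hk]
          exact_mod_cast zero_le
        exact (support_of_supportDim_eq_zero R M h1).le
    exact Ideal.exists_pow_le_of_le_radical_of_fg hrad (IsNoetherian.noetherian _)
  · rintro ⟨n, hn⟩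
    have : Subsingleton (support R M) := by
      have key : ∀ p ∈ support R M, p.asIdeal = maximalIdeal R := by
        intro p hp
        rw [mem_support_iff_of_finite] at hp
        exact ((maximalIdeal.isMaximal R).eq_of_le p.2.ne_top
          (Ideal.IsPrime.le_of_pow_le (hn.trans hp))).symm
      exact ⟨fun p q => Subtype.ext (PrimeSpectrum.ext ((key _ p.2).trans (key _ q.2).symm))⟩
    exact Order.krullDim_nonpos_of_subsingleton

lemma mem_H0sub (y : M) : y ∈ H0sub R M ↔
    ∃ n, y ∈ Submodule.torsionBySet R M (((maximalIdeal R) ^ n : Ideal R) : Set R) := by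
  unfold H0sub
  refine Submodule.mem_iSup_of_directed _ (Monotone.directed_le ?_)
  intro i j hij
  exact Submodule.torsionBySet_le_torsionBySet_of_subset (Ideal.pow_le_pow_right hij)

lemma le_H0_iff (N : Submodule R M) : N ≤ H0sub R M ↔ supportDim R N ≤ 0 := by
  rw [sdim_le_zero_iff]
  constructor
  · intro h
    let f : ℕ →o Submodule R M := ⟨fun n =>
      Submodule.torsionBySet R M (((maximalIdeal R) ^ n : Ideal R) : Set R), fun i j hij =>
        Submodule.torsionBySet_le_torsionBySet_of_subset (Ideal.pow_le_pow_right hij)⟩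
    obtain ⟨n, hn⟩ := monotone_stabilizes_iff_noetherian.mpr (inferInstance : IsNoetherian R M) f
    refine ⟨n, fun r hr => mem_annihilator.mpr fun y => Subtype.ext ?_⟩
    obtain ⟨k, hk⟩ := (mem_H0sub _).mp (h y.2)
    have h1 : (y : M) ∈ f n := by
      rw [hn (max n k) (le_max_left _ _)]
      exact f.2 (le_max_right n k) hk
    exact (Submodule.mem_torsionBySet_iff _ _).mp h1 ⟨r, hr⟩
  · rintro ⟨n, hn⟩ y hy
    rw [mem_H0sub]
    refine ⟨n, (Submodule.mem_torsionBySet_iff _ _).mpr fun r => ?_⟩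
    exact congrArg Subtype.val (mem_annihilator.mp (hn r.2) ⟨y, hy⟩)

lemma sdim_of_finiteLength (h : IsFiniteLength R M) : supportDim R M ≤ 0 := by
  rw [sdim_le_zero_iff]
  have := (isFiniteLength_iff_isNoetherian_isArtinian.mp h).2
  let f : ℕ →o (Submodule R M)ᵒᵈ := ⟨fun n => OrderDual.toDual ((maximalIdeal R) ^ n • (⊤ : Submodule R M)), fun i j hij =>
        Submodule.smul_mono_left (Ideal.pow_le_pow_right hij)⟩
  obtain ⟨n, hn⟩ := IsArtinian.monotone_stabilizes f
  have h1 : (maximalIdeal R) ^ n • (⊤ : Submodule R M) = (maximalIdeal R) ^ (n+1) • (⊤ : Submodule R M) :=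
    hn (n+1) (by omega)
  have h2 : (maximalIdeal R) ^ n • (⊤ : Submodule R M) = ⊥ := by
    apply Submodule.eq_bot_of_le_smul_of_le_jacobson_bot (maximalIdeal R) _ (IsNoetherian.noetherian _)
    · conv_lhs => rw [h1]
      rw [pow_succ', mul_smul]
    · rw [jacobson_eq_maximalIdeal _ bot_ne_top]
  refine ⟨n, fun r hr => mem_annihilator.mpr fun y => ?_⟩
  have := Submodule.smul_mem_smul hr (Submodule.mem_top (x := y))
  rw [h2] at this
  exact this

lemma finiteLength_of_sdim (h : supportDim R M ≤ 0) : IsFiniteLength R M := by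
  rw [isFiniteLength_iff_isNoetherian_isArtinian]
  refine ⟨inferInstance, ?_⟩
  rcases subsingleton_or_nontrivial M with h0 | h0
  · infer_instance
  rw [supportDim_eq_ringKrullDim_quotient_annihilator] at h
  have h1 : Ring.KrullDimLE 0 (R ⧸ annihilator R M) := by
    rw [Ring.krullDimLE_iff]; exact_mod_cast h
  have h2 : IsArtinianRing (R ⧸ annihilator R M) := by
    exact isArtinianRing_iff_isNoetherianRing_krullDimLE_zero.mpr ⟨inferInstance, h1⟩
  let _ : Module (R ⧸ annihilator R M) M := Module.quotientAnnihilator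
  have : IsScalarTower R (R ⧸ annihilator R M) M := IsScalarTower.of_algebraMap_smul fun r x => rfl
  have : Module.Finite (R ⧸ annihilator R M) M := Module.Finite.of_restrictScalars_finite R _ _
  have h3 : IsArtinian (R ⧸ annihilator R M) M := inferInstance
  exact isArtinian_of_surjective_algebraMap (R := R ⧸ annihilator R M) (S := R)
     (M := M) Ideal.Quotient.mk_surjective
end zero

section transfer
variable {M M' : Type u} [AddCommGroup M] [Module R M] [Module.Finite R M]
  [AddCommGroup M'] [Module R M'] [Module.Finite R M']

lemma isCM_congr (e : M ≃ₗ[R] M') : IsCM R M ↔ IsCM R M' := by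
  unfold IsCM depth
  rw [mdim_eq, mdim_eq, supportDim_eq_of_equiv e]
  simp only [e.isRegular_congr]

lemma exists_map_eq {f : M →ₗ[R] M'} {N : Submodule R M} {P : Submodule R M'}
    (h : P ≤ N.map f) : ∃ Q ≤ N, Q.map f = P := by
  refine ⟨N ⊓ P.comap f, inf_le_left, le_antisymm ?_ ?_⟩
  · rintro _ ⟨x, hx, rfl⟩
    exact hx.2
  · intro y hy
    obtain ⟨x, hx, rfl⟩ := h hy
    exact ⟨x, ⟨hx, hy⟩, rfl⟩

variable {f : M →ₗ[R] M'} {U : Submodule R M}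

lemma bij (hf : ∀ u ∈ U, f u = 0 → u = 0)
    {N : Submodule R M} (hN : N ≤ U) : Function.Bijective (f.submoduleMap N) := by
  refine ⟨?_, f.submoduleMap_surjective N⟩
  rw [← LinearMap.ker_eq_bot, LinearMap.ker_eq_bot']
  intro m hm
  exact Subtype.ext (hf m (hN m.2) (congrArg Subtype.val hm))

lemma sdim_map (hf : ∀ u ∈ U, f u = 0 → u = 0)
    {N : Submodule R M} (hN : N ≤ U) :
    supportDim R (N.map f) = supportDim R N :=
  (supportDim_eq_of_equiv (LinearEquiv.ofBijective _ (bij hf hN))).symm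

lemma map_le_iff (hf : ∀ u ∈ U, f u = 0 → u = 0)
    {N P : Submodule R M} (hN : N ≤ U) (hP : P ≤ U) :
    N.map f ≤ P.map f ↔ N ≤ P := by
  refine ⟨fun h x hx => ?_, fun h => Submodule.map_mono h⟩
  obtain ⟨y, hy, hxy⟩ := h (Submodule.mem_map_of_mem hx)
  have : x - y = 0 := hf _ (U.sub_mem (hN hx) (hP hy)) (by rw [map_sub, hxy, sub_self])
  rw [sub_eq_zero.mp this]; exact hy

lemma map_inj (hf : ∀ u ∈ U, f u = 0 → u = 0)
    {N P : Submodule R M} (hN : N ≤ U) (hP : P ≤ U) (h : N.map f = P.map f) : N = P :=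
  le_antisymm ((map_le_iff hf hN hP).mp h.le) ((map_le_iff hf hP hN).mp h.ge)

lemma uComp_map (hf : ∀ u ∈ U, f u = 0 → u = 0)
    {N : Submodule R M} (hN : N ≤ U) :
    uComp R M' (N.map f) = (uComp R M N).map f := by
  by_cases h0 : N = ⊥
  · rw [h0, Submodule.map_bot, uComp_bot, uComp_bot, Submodule.map_bot]
  have h0' : N.map f ≠ ⊥ := fun h => h0 (map_inj hf hN bot_le (by rw [h, Submodule.map_bot]))
  apply le_antisymm
  · obtain ⟨Q, hQ, hQ'⟩ := exists_map_eq (uComp_le (N.map f))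
    rw [← hQ']
    apply Submodule.map_mono
    apply le_uComp hQ
    rw [← sdim_map hf (hQ.trans hN), ← sdim_map hf hN, hQ']
    exact sdim_uComp h0'
  · apply le_uComp (Submodule.map_mono (uComp_le N))
    rw [sdim_map hf ((uComp_le N).trans hN), sdim_map hf hN]
    exact sdim_uComp h0

lemma subQuot_equiv (hf : ∀ u ∈ U, f u = 0 → u = 0)
    {N K : Submodule R M} (hN : N ≤ U) (hK : K ≤ N) :
    Nonempty (subQuot R M N K ≃ₗ[R] subQuot R M' (N.map f) (K.map f)) := by
  refine ⟨Submodule.Quotient.equiv _ _ (LinearEquiv.ofBijective _ (bij hf hN)) ?_⟩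
  ext ⟨y, hy⟩
  constructor
  · rintro ⟨x, hx, hxy⟩
    exact ⟨x, hx, congrArg Subtype.val hxy⟩
  · rintro ⟨x, hx, hxy⟩
    exact ⟨⟨x, hK hx⟩, hx, Subtype.ext hxy⟩

lemma SC_map (hf : ∀ u ∈ U, f u = 0 → u = 0)
    (hH : H0sub R M' = (H0sub R M).map f) (hHU : H0sub R M ≤ U)
    {N : Submodule R M} (h : SC R M N) : N ≤ U → SC R M' (N.map f) := by
  induction h with
  | base => intro _; rw [← hH]; exact SC.base
  | step N h1 h2 ih =>
    intro hN
    obtain ⟨e⟩ := subQuot_equiv hf hN (uComp_le N)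
    refine SC.step _ ?_ ?_
    · rw [uComp_map hf hN]; exact (isCM_congr e).mp h1
    · rw [uComp_map hf hN]; exact ih ((uComp_le N).trans hN)

lemma SC_of_map (hf : ∀ u ∈ U, f u = 0 → u = 0)
    (hH : H0sub R M' = (H0sub R M).map f) (hHU : H0sub R M ≤ U)
    {N' : Submodule R M'} (h : SC R M' N') :
    ∀ N : Submodule R M, N ≤ U → N.map f = N' → SC R M N := by
  induction h with
  | base => 
    intro N hN h
    rw [hH] at h
    rw [map_inj hf hN hHU h]; exact SC.base
  | step N' h1 h2 ih =>
    rintro N hN rfl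
    obtain ⟨e⟩ := subQuot_equiv hf hN (uComp_le N)
    rw [uComp_map hf hN] at h1
    exact SC.step _ ((isCM_congr e).mpr h1)
      (ih _ ((uComp_le N).trans hN) (uComp_map hf hN).symm)

end transfer
end
end SCM

set_option linter.unusedSectionVars false
set_option linter.unusedVariables false
namespace SCM
open Module CategoryTheory Abelian
section
variable {R : Type u} [CommRing R] [IsLocalRing R] [IsNoetherianRing R]

lemma sdim_le_of_support {M N : Type u} [AddCommGroup M] [Module R M] [AddCommGroup N] [Module R N]
    (h : support R M ⊆ support R N) : supportDim R M ≤ supportDim R N :=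
  Order.krullDim_le_of_strictMono (fun a ↦ ⟨a.1, h a.2⟩) (fun {_ _} lt ↦ lt)

variable {M : Type u} [AddCommGroup M] [Module R M] [Module.Finite R M]

lemma avoid (n : ℕ) (hM : supportDim R M ≤ ((n + 1 : ℕ) : WithBot ℕ∞)) (I : Ideal R)
    (hI : ∀ p : Ideal R, p.IsPrime → I ≤ p → ringKrullDim (R ⧸ p) ≤ (n : WithBot ℕ∞)) :
    ∃ y ∈ I, supportDim R (QuotSMulTop y M) ≤ (n : WithBot ℕ∞) := by
  let S : Set (Ideal R) := {p | p ∈ (annihilator R M).minimalPrimes ∧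
    (n : WithBot ℕ∞) < ringKrullDim (R ⧸ p)}
  have hS : S.Finite := (Ideal.finite_minimalPrimes_of_isNoetherianRing R _).subset fun p hp => hp.1
  have hnot : ¬ ((I : Set R) ⊆ ⋃ p ∈ S, (p : Set R)) := by
    intro h
    obtain ⟨p, hp, hle⟩ := (Ideal.subset_union_prime_finite hS (f := id) ⊤ ⊤
      (fun p hp _ _ => hp.1.1.1)).mp h
    exact absurd (hI p hp.1.1.1 hle) (not_le.mpr hp.2)
  obtain ⟨y, hyI, hy⟩ := Set.not_subset.mp hnot
  refine ⟨y, hyI, iSup_le fun c => ?_⟩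
  have hc : c.head.1 ∈ support R (QuotSMulTop y M) := c.head.2
  have hc1 := (Module.support_quotSMulTop (M := M) y).le hc
  have hann : annihilator R M ≤ c.head.1.asIdeal := mem_support_iff_of_finite.mp hc1.1
  have hyc : y ∈ c.head.1.asIdeal := by
    have := hc1.2
    simpa [PrimeSpectrum.mem_zeroLocus] using this
  obtain ⟨q, hq, hqc⟩ := Ideal.exists_minimalPrimes_le hann
  have hqp : q.IsPrime := hq.1.1
  by_cases hqS : q ∈ S
  · have hyq : y ∉ q := fun h => hy (Set.mem_biUnion hqS h)
    have hlt : (⟨q, hqp⟩ : PrimeSpectrum R) < c.head.1 := by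
      rw [← PrimeSpectrum.asIdeal_lt_asIdeal]
      refine lt_of_le_of_ne hqc (fun h => hyq ?_)
      have h' : q = c.head.1.asIdeal := h
      rw [h']; exact hyc
    have hqsupp : (⟨q, hqp⟩ : PrimeSpectrum R) ∈ support R M :=
      mem_support_iff_of_finite.mpr hq.1.2
    let c' : LTSeries (support R M) := ⟨c.length, fun i => ⟨(c i).1,
      ((Module.support_quotSMulTop (M := M) y).le (c i).2).1⟩, fun i => c.step i⟩
    let c'' : LTSeries (support R M) := c'.cons ⟨_, hqsupp⟩ hlt
    have h1 : ((c''.length : ℕ) : WithBot ℕ∞) ≤ supportDim R M := le_iSup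
      (fun p : LTSeries (support R M) => (p.length : WithBot ℕ∞)) c''
    have h2 : c''.length = c.length + 1 := by
      change 0 + c.length + 1 = c.length + 1
      omega
    rw [h2] at h1
    have h3 := h1.trans hM
    have h4 : c.length + 1 ≤ n + 1 := by exact_mod_cast h3
    have h5 : c.length ≤ n := by omega
    exact_mod_cast h5
  · have hle : ringKrullDim (R ⧸ q) ≤ (n : WithBot ℕ∞) := by
      by_contra h
      exact hqS ⟨hq, not_le.mp h⟩
    refine le_trans ?_ hle
    rw [← supportDim_quotient_eq_ringKrullDim]
    have hmem : ∀ i, (c i).1 ∈ support R (R ⧸ q) := fun i => by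
      rw [mem_support_iff_of_finite, Ideal.annihilator_quotient]
      exact hqc.trans (c.head_le i)
    exact le_iSup (fun p : LTSeries (support R (R ⧸ q)) => (p.length : WithBot ℕ∞))
      ⟨c.length, fun i => ⟨(c i).1, hmem i⟩, fun i => c.step i⟩

lemma support_cons (y : R) (S T : Set R) (h : T = insert y S) :
    support R (M ⧸ (Ideal.span T • ⊤ : Submodule R M)) =
      support R (QuotSMulTop y M ⧸ (Ideal.span S • ⊤ : Submodule R (QuotSMulTop y M))) := by
  rw [Module.support_quotient, Module.support_quotient, Module.support_quotSMulTop, h,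
    PrimeSpectrum.zeroLocus_span, PrimeSpectrum.zeroLocus_span, Set.insert_eq,
    PrimeSpectrum.zeroLocus_union, Set.inter_assoc]

lemma sop_cons {n : ℕ} {y : R} (hy : y ∈ maximalIdeal R) {x : Fin n → R}
    (hx : IsSOP R (QuotSMulTop y M) n x) : IsSOP R M (n+1) (Fin.cons y x) := by
  refine ⟨fun i => ?_, finiteLength_of_sdim ?_⟩
  · induction i using Fin.cases with
    | zero => simpa using hy
    | succ i => simpa using hx.1 i
  · exact (sdim_le_of_support (support_cons y (Set.range x) _ (Fin.range_cons y x)).le).trans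
      (sdim_of_finiteLength hx.2)

lemma maxIdeal_avoid (n : ℕ) (p : Ideal R) (hp : p.IsPrime) (h : maximalIdeal R ≤ p) :
    ringKrullDim (R ⧸ p) ≤ (n : WithBot ℕ∞) := by
  have : p = maximalIdeal R := ((maximalIdeal.isMaximal R).eq_of_le hp.ne_top h).symm
  subst this
  have h0 : ringKrullDim (R ⧸ maximalIdeal R) = 0 := by
    let _ := Ideal.Quotient.field (maximalIdeal R)
    exact ringKrullDim_eq_zero_of_field _
  rw [h0]
  exact_mod_cast Nat.zero_le n

lemma exists_sop (n : ℕ) : ∀ (M : Type u) [AddCommGroup M] [Module R M] [Module.Finite R M],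
    supportDim R M ≤ (n : WithBot ℕ∞) → ∃ x : Fin n → R, IsSOP R M n x := by
  induction n with
  | zero =>
    intro M _ _ _ h
    refine ⟨Fin.elim0, fun i => i.elim0, finiteLength_of_sdim ?_⟩
    exact (supportDim_le_of_surjective _ (Submodule.mkQ_surjective _)).trans (by exact_mod_cast h)
  | succ n ih =>
    intro M _ _ _ h
    obtain ⟨y, hy, hyd⟩ := avoid n h (maximalIdeal R) (maxIdeal_avoid n)
    obtain ⟨x, hx⟩ := ih _ hyd
    exact ⟨_, sop_cons hy hx⟩

lemma exists_sop_first {n : ℕ} (h : supportDim R M = ((n + 1 : ℕ) : WithBot ℕ∞))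
    (U : Submodule R M) (hU : supportDim R U < ((n + 1 : ℕ) : WithBot ℕ∞)) :
    ∃ x : Fin (n+1) → R, IsSOP R M (n+1) x ∧ x 0 ∈ annihilator R U := by
  obtain ⟨y, hy, hyd⟩ := avoid n h.le (annihilator R U ⊓ maximalIdeal R) (by
    intro p hp hle
    rcases (Ideal.IsPrime.inf_le hp).mp hle with h1 | h1
    · have h2 : ringKrullDim (R ⧸ p) ≤ supportDim R U := by
        rw [supportDim_eq_ringKrullDim_quotient_annihilator]
        exact ringKrullDim_le_of_surjective (Ideal.Quotient.factor h1)
          (Ideal.Quotient.factor_surjective h1)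
      have h3 := h2.trans_lt hU
      push_cast at h3
      exact ENat.WithBot.lt_add_one_iff.mp h3
    · exact maxIdeal_avoid n p hp h1)
  obtain ⟨x, hx⟩ := exists_sop n _ hyd
  exact ⟨_, sop_cons hy.2 hx, by simpa using hy.1⟩

lemma sdim_le_card (s : Finset R) : ∀ (M : Type u) [AddCommGroup M] [Module R M]
    [Module.Finite R M], (∀ r ∈ s, r ∈ maximalIdeal R) →
    supportDim R M ≤ supportDim R (M ⧸ (Ideal.span (s : Set R) • ⊤ : Submodule R M)) + s.card := by
  classical
  induction s using Finset.induction_on with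
  | empty =>
    intro M _ _ _ _
    have : (Ideal.span ((∅ : Finset R) : Set R) • ⊤ : Submodule R M) = ⊥ := by simp
    rw [supportDim_eq_of_equiv (Submodule.quotEquivOfEqBot _ this)]
    simp
  | insert a s ha ih =>
    intro M _ _ _ hs
    have h1 := supportDim_le_supportDim_quotSMulTop_succ (M := M) (hs a (by simp))
    have h2 := ih (QuotSMulTop a M) (fun r hr => hs r (by simp [hr]))
    have h3 := sdim_le_of_support (support_cons (M := M) a (s : Set R) _ (Finset.coe_insert a s)).ge
    rw [Finset.card_insert_of_notMem ha]
    push_cast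
    rw [← add_assoc]
    refine h1.trans ?_
    gcongr
    refine h2.trans ?_
    gcongr

lemma param_sdim {n : ℕ} {a : R} (h : IsParamElement R M (n+1) a) :
    a ∈ maximalIdeal R ∧ supportDim R (QuotSMulTop a M) ≤ (n : WithBot ℕ∞) := by
  classical
  obtain ⟨x, hx, i, rfl⟩ := h
  refine ⟨hx.1 i, ?_⟩
  let s : Finset R := (Finset.univ.erase i).image x
  have h1 := sdim_le_card s (QuotSMulTop (x i) M) (by
    intro r hr
    obtain ⟨j, -, rfl⟩ := Finset.mem_image.mp hr
    exact hx.1 j)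
  have hcard : s.card ≤ n := Finset.card_image_le.trans (by simp)
  have hset : Set.range x = insert (x i) (s : Set R) := by
    ext r
    simp only [s, Set.mem_range, Set.mem_insert_iff, Finset.coe_image, Set.mem_image,
      Finset.mem_coe, Finset.mem_erase, Finset.mem_univ, and_true]
    constructor
    · rintro ⟨j, rfl⟩
      by_cases hj : j = i
      · left; rw [hj]
      · right; exact ⟨j, hj, rfl⟩
    · rintro (rfl | ⟨j, -, rfl⟩)
      · exact ⟨i, rfl⟩
      · exact ⟨j, rfl⟩
  have h2 := (sdim_le_of_support (support_cons (M := M) (x i) (s : Set R) _ hset).ge).trans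
    (sdim_of_finiteLength hx.2)
  refine h1.trans ?_
  calc _ ≤ (0 : WithBot ℕ∞) + (n : WithBot ℕ∞) := by
        gcongr
    _ = n := zero_add _

lemma sdim_of_killed {a : R} {K : Submodule R M} (h : ∀ m ∈ K, a ^ 2 • m = 0) :
    supportDim R K ≤ supportDim R (QuotSMulTop a M) := by
  apply sdim_le_of_support
  intro p hp
  rw [Module.support_quotSMulTop]
  refine ⟨support_subset_of_injective _ K.subtype_injective hp, ?_⟩
  rw [mem_support_iff_of_finite] at hp
  have : a ^ 2 ∈ annihilator R K := mem_annihilator.mpr fun m => Subtype.ext (h m m.2)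
  have := p.2.mem_of_pow_mem _ (hp this)
  simpa [PrimeSpectrum.mem_zeroLocus] using this

lemma b_kills {n : ℕ} (h : supportDim R M = ((n + 1 : ℕ) : WithBot ℕ∞))
    (U : Submodule R M) (hU : supportDim R U < ((n + 1 : ℕ) : WithBot ℕ∞)) {a : R}
    (ha : a ∈ bIdeal R M (n+1)) : ∀ u ∈ U, a • u = 0 := by
  intro u hu
  obtain ⟨x, hx, hx0⟩ := exists_sop_first h U hU
  unfold bIdeal at ha
  simp only [Ideal.mem_iInf] at ha
  have h1 := ha x hx 0
  have hspan : (Ideal.span (x '' {j | j < 0}) • ⊤ : Submodule R M) = ⊥ := by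
    have : {j : Fin (n+1) | j < 0} = ∅ := by ext j; simp
    rw [this]; simp
  have hmem : (Submodule.Quotient.mk u : M ⧸ (Ideal.span (x '' {j | j < 0}) • ⊤ : Submodule R M)) ∈
      Submodule.torsionBy R (M ⧸ (Ideal.span (x '' {j | j < 0}) • ⊤ : Submodule R M)) (x 0) := by
    rw [Submodule.mem_torsionBy_iff, ← Submodule.Quotient.mk_smul]
    have : x 0 • u = 0 := congrArg Subtype.val (mem_annihilator.mp hx0 ⟨u, hu⟩)
    rw [this]; rfl
  have h2 := congrArg Subtype.val (mem_annihilator.mp h1 ⟨_, hmem⟩)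
  have h3 : (Submodule.Quotient.mk (a • u) : M ⧸ (Ideal.span (x '' {j | j < 0}) • ⊤ : Submodule R M)) = 0 := h2
  rw [Submodule.Quotient.mk_eq_zero, hspan] at h3
  exact h3
end
end SCM

set_option linter.unusedSectionVars false
set_option linter.unusedVariables false
namespace SCM
open Module CategoryTheory Abelian
section
variable {R : Type u} [CommRing R] [IsLocalRing R] [IsNoetherianRing R]
variable {M : Type u} [AddCommGroup M] [Module R M] [Module.Finite R M]
variable {M' : Type u} [AddCommGroup M'] [Module R M'] [Module.Finite R M']

lemma SC_inv {N : Submodule R M} (h : SC R M N) : N = H0sub R M ∨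
    (IsCM R (subQuot R M N (uComp R M N)) ∧ SC R M (uComp R M N)) := by
  induction h with
  | base => exact Or.inl rfl
  | step N h1 h2 _ => exact Or.inr ⟨h1, h2⟩

lemma SC_iff_of_pos {N : Submodule R M} (h : 0 < supportDim R N) : SC R M N ↔
    (IsCM R (subQuot R M N (uComp R M N)) ∧ SC R M (uComp R M N)) := by
  refine ⟨fun hs => (SC_inv hs).resolve_left fun he => ?_, fun hs => SC.step _ hs.1 hs.2⟩
  exact absurd ((le_H0_iff N).mp he.le) (not_le.mpr h)

lemma nontriv_of_sdim {N : Type u} [AddCommGroup N] [Module R N] {n : ℕ}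
    (h : supportDim R N = (n : WithBot ℕ∞)) : Nontrivial N := by
  by_contra h0
  rw [not_nontrivial_iff_subsingleton] at h0
  rw [supportDim_eq_bot_of_subsingleton] at h
  exact WithBot.bot_ne_coe h

lemma sdim_top : supportDim R (⊤ : Submodule R M) = supportDim R M :=
  supportDim_eq_of_equiv Submodule.topEquiv

noncomputable def topq (K : Submodule R M) : subQuot R M ⊤ K ≃ₗ[R] (M ⧸ K) :=
  Submodule.Quotient.equiv _ _ Submodule.topEquiv (by
    ext x
    simp)

lemma sdim_quot_eq {n : ℕ} (hM : supportDim R M = (n : WithBot ℕ∞)) {K : Submodule R M}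
    (hK : supportDim R K < (n : WithBot ℕ∞)) : supportDim R (M ⧸ K) = (n : WithBot ℕ∞) := by
  refine le_antisymm ?_ ?_
  · rw [← hM]; exact supportDim_le_of_surjective _ K.mkQ_surjective
  · have := sdim_quot K (le_max_left (supportDim R K) (supportDim R (M ⧸ K))) (le_max_right _ _)
    rw [hM, le_max_iff] at this
    exact this.resolve_left (not_le.mpr hK)

lemma sdim_subQuot {n : ℕ} {N K : Submodule R M} (hKN : K ≤ N)
    (hM : supportDim R N = (n : WithBot ℕ∞))
    (hK : supportDim R K < (n : WithBot ℕ∞)) :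
    supportDim R (subQuot R M N K) = (n : WithBot ℕ∞) := by
  apply sdim_quot_eq hM
  rwa [supportDim_eq_of_equiv (Submodule.comapSubtypeEquivOfLe hKN)]

lemma ne_bot_of_sdim {n : ℕ} {N : Submodule R M} (h : supportDim R N = (n : WithBot ℕ∞)) :
    N ≠ ⊥ := (Submodule.nontrivial_iff_ne_bot).mp (nontriv_of_sdim h)

/-- For `K ≤ N`, the sequence `0 → N/K → M/K → M/N → 0`. -/
lemma ev_mid {n : ℕ} {N K : Submodule R M} (hKN : K ≤ N) (h2 : EV R n (M ⧸ N)) :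
    EV R n (subQuot R M N K) ↔ EV R n (M ⧸ K) := by
  let i : subQuot R M N K →ₗ[R] M ⧸ K := Submodule.mapQ _ _ N.subtype le_rfl
  let g : (M ⧸ K) →ₗ[R] M ⧸ N := Submodule.factor hKN
  have hi : Function.Injective i := by
    rw [← LinearMap.ker_eq_bot, LinearMap.ker_eq_bot']
    intro q hq
    obtain ⟨x, rfl⟩ := Submodule.mkQ_surjective _ q
    have h3 : (Submodule.Quotient.mk (x : M) : M ⧸ K) = 0 := hq
    rw [Submodule.Quotient.mk_eq_zero] at h3
    exact (Submodule.Quotient.mk_eq_zero _).mpr h3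
  have hg : Function.Surjective g := Submodule.factor_surjective hKN
  have hex : Function.Exact i g := by
    intro q
    constructor
    · intro hq
      obtain ⟨x, rfl⟩ := Submodule.mkQ_surjective _ q
      have h3 : (Submodule.Quotient.mk x : M ⧸ N) = 0 := hq
      rw [Submodule.Quotient.mk_eq_zero] at h3
      exact ⟨Submodule.Quotient.mk ⟨x, h3⟩, rfl⟩
    · rintro ⟨y, rfl⟩
      obtain ⟨x, rfl⟩ := Submodule.mkQ_surjective _ y
      exact (Submodule.Quotient.mk_eq_zero _).mpr x.2
  exact ⟨fun h => EV.mid hex hi hg h h2, fun h => EV.left hex hi hg h h2⟩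

lemma cm_top {n : ℕ} {K : Submodule R M} (hM : supportDim R M = (n : WithBot ℕ∞))
    (hK : supportDim R K < (n : WithBot ℕ∞)) : IsCM R (subQuot R M ⊤ K) ↔ EV R n (M ⧸ K) := by
  have h := sdim_quot_eq hM hK
  have := nontriv_of_sdim h
  rw [isCM_congr (topq K), isCM_iff h]

lemma core {f : M →ₗ[R] M'} {U : Submodule R M} (hf : ∀ u ∈ U, f u = 0 → u = 0) {n : ℕ}
    (hn : 0 < n) (hHU : H0sub R M ≤ U) (hEV : EV R n (M' ⧸ U.map f))
    (hd : supportDim R M' = (n : WithBot ℕ∞)) (hU : supportDim R U ≤ (n : WithBot ℕ∞)) :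
    SC R M U ↔ SC R M' ⊤ := by
  have hn' : (0 : WithBot ℕ∞) < (n : WithBot ℕ∞) := by exact_mod_cast hn
  have hH : H0sub R M' = (H0sub R M).map f := by
    apply le_antisymm
    · have h1 : H0sub R M' ≤ U.map f := le_of_sdim_lt hEV
        (((le_H0_iff _).mp le_rfl).trans_lt hn')
      obtain ⟨Q, hQ, hQe⟩ := exists_map_eq h1
      rw [← hQe]
      apply Submodule.map_mono
      rw [le_H0_iff, ← sdim_map hf hQ, hQe]
      exact (le_H0_iff _).mp le_rfl
    · rw [le_H0_iff, sdim_map hf hHU]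
      exact (le_H0_iff _).mp le_rfl
  have htr : ∀ N ≤ U, (SC R M N ↔ SC R M' (N.map f)) := fun N hN =>
    ⟨fun h => SC_map hf hH hHU h hN, fun h => SC_of_map hf hH hHU h N hN rfl⟩
  have hd' : supportDim R (⊤ : Submodule R M') = (n : WithBot ℕ∞) := sdim_top.trans hd
  rw [SC_iff_of_pos (N := (⊤ : Submodule R M')) (by rw [hd']; exact hn')]
  have hlt := sdim_uComp (ne_bot_of_sdim hd')
  rw [hd'] at hlt
  rw [cm_top hd hlt]
  rcases hU.lt_or_eq with hlt' | heq
  · have hu : uComp R M' ⊤ = U.map f := by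
      apply le_antisymm
      · exact le_of_sdim_lt hEV hlt
      · apply le_uComp le_top
        rw [hd', sdim_map hf le_rfl]
        exact hlt'
    rw [hu, htr U le_rfl]
    exact ⟨fun h => ⟨hEV, h⟩, fun h => h.2⟩
  · have heqW : supportDim R (U.map f) = (n : WithBot ℕ∞) := (sdim_map hf le_rfl).trans heq
    have hu : uComp R M' ⊤ = uComp R M' (U.map f) := by
      apply le_antisymm
      · apply le_uComp (le_of_sdim_lt hEV hlt)
        rw [heqW]; exact hlt
      · apply le_uComp le_top
        rw [hd', ← heqW]
        exact sdim_uComp (ne_bot_of_sdim heqW)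
    have hUU := uComp_le (R := R) U
    have hltU := sdim_uComp (ne_bot_of_sdim heq)
    rw [heq] at hltU
    have hq := sdim_subQuot hUU heq hltU
    have := nontriv_of_sdim hq
    obtain ⟨e⟩ := subQuot_equiv hf le_rfl hUU
    rw [hu, uComp_map hf le_rfl, SC_iff_of_pos (N := U) (by rw [heq]; exact hn'), isCM_iff hq,
      htr _ hUU, ← ev_mid (Submodule.map_mono hUU) hEV]
    exact and_congr_left' ⟨fun h => h.congr e, fun h => h.congr e.symm⟩

open scoped Pointwise in
theorem main {n : ℕ} (hdim : supportDim R M = ((n + 1 : ℕ) : WithBot ℕ∞)) {a : R}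
    (ha : a ∈ bIdeal R M (n+1)) (hpe : IsParamElement R M (n+1) a) :
    SC R M ⊤ ↔ SC R (M ⧸ (Ideal.span {a} • ⊤ : Submodule R M)) ⊤ ∧
        IsCM R (M ⧸ uComp R M ⊤) := by
  obtain ⟨ham, had⟩ := param_sdim hpe
  have hlt1 : (n : WithBot ℕ∞) < ((n + 1 : ℕ) : WithBot ℕ∞) := by exact_mod_cast Nat.lt_succ_self n
  have hpos : (0 : WithBot ℕ∞) < ((n + 1 : ℕ) : WithBot ℕ∞) := by exact_mod_cast Nat.succ_pos n
  have htop : supportDim R (⊤ : Submodule R M) = ((n + 1 : ℕ) : WithBot ℕ∞) := sdim_top.trans hdim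
  rw [SC_iff_of_pos (by rw [htop]; exact hpos), isCM_congr (topq _), and_comm]
  refine and_congr_left fun hCM => ?_
  have hU := sdim_uComp (ne_bot_of_sdim htop)
  have hleU : ∀ P : Submodule R M, supportDim R P < ((n + 1 : ℕ) : WithBot ℕ∞) →
      P ≤ uComp R M ⊤ := fun P hP => le_uComp le_top (by rw [htop]; exact hP)
  rw [htop] at hU
  generalize uComp R M ⊤ = U at *
  have hkill := b_kills hdim U hU ha
  have hdMU := sdim_quot_eq hdim hU
  have := nontriv_of_sdim hdMU
  have hEV1 := (isCM_iff hdMU).mp hCM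
  have hcol : ∀ m : M, a • m ∈ U → m ∈ U := by
    have h1 : U.comap (LinearMap.lsmul R M a) ≤ U := by
      apply hleU
      refine ((sdim_of_killed (a := a) ?_).trans had).trans_lt hlt1
      intro m hm
      rw [pow_two, mul_smul]
      exact hkill _ hm
    exact fun m hm => h1 hm
  have hreg : IsSMulRegular (M ⧸ U) a := by
    rw [isSMulRegular_iff_right_eq_zero_of_smul]
    intro q hq
    obtain ⟨x, rfl⟩ := Submodule.mkQ_surjective _ q
    have h3 : (Submodule.Quotient.mk (a • x) : M ⧸ U) = 0 := hq
    rw [Submodule.Quotient.mk_eq_zero] at h3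
    exact (Submodule.Quotient.mk_eq_zero _).mpr (hcol x h3)
  have hEVn := EV.quotSMulTop hreg hEV1
  have hdQ : supportDim R (QuotSMulTop a (M ⧸ U)) = (n : WithBot ℕ∞) := by
    have h1 := supportDim_quotSMulTop_succ_eq_supportDim hreg ham
    rw [hdMU] at h1
    push_cast at h1
    exact (ENat.WithBot.add_one_cancel).mp h1
  have hspan : (Ideal.span {a} • ⊤ : Submodule R M) = a • ⊤ :=
    Submodule.ideal_span_singleton_smul a ⊤
  rw [hspan]
  change _ ↔ SC R (QuotSMulTop a M) ⊤
  let f : M →ₗ[R] QuotSMulTop a M := Submodule.mkQ _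
  have hf : ∀ u ∈ U, f u = 0 → u = 0 := by
    intro u hu h0
    have h1 : u ∈ (a • ⊤ : Submodule R M) := (Submodule.Quotient.mk_eq_zero _).mp h0
    obtain ⟨m, -, rfl⟩ := h1
    exact hkill m (hcol m hu)
  -- the quotient of `M/aM` by the image of `U`
  let g : QuotSMulTop a M →ₗ[R] QuotSMulTop a (M ⧸ U) := QuotSMulTop.map a U.mkQ
  have hg : Function.Surjective g := QuotSMulTop.map_surjective a U.mkQ_surjective
  have hker : LinearMap.ker g = U.map f := by
    ext q
    obtain ⟨x, rfl⟩ := Submodule.mkQ_surjective _ q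
    rw [LinearMap.mem_ker]
    constructor
    · intro h
      have h1 : U.mkQ x ∈ (a • ⊤ : Submodule R (M ⧸ U)) := (Submodule.Quotient.mk_eq_zero _).mp h
      obtain ⟨y, -, hy⟩ := h1
      obtain ⟨y, rfl⟩ := Submodule.mkQ_surjective _ y
      have h2 : U.mkQ (a • y) = U.mkQ x := hy
      have h3 : x - a • y ∈ U := by
        rw [← Submodule.ker_mkQ U, LinearMap.mem_ker, map_sub, h2, sub_self]
      refine ⟨_, h3, ?_⟩
      rw [map_sub]
      have h4 : f (a • y) = 0 := (Submodule.Quotient.mk_eq_zero _).mpr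
        (Submodule.smul_mem_pointwise_smul y a ⊤ trivial)
      rw [h4, sub_zero]
    · rintro ⟨u, hu, hux⟩
      change f u = f x at hux
      change g (f x) = 0
      rw [← hux]
      have h1 : U.mkQ u = 0 := (Submodule.Quotient.mk_eq_zero _).mpr hu
      change (Submodule.mkQ _ (U.mkQ u) : QuotSMulTop a (M ⧸ U)) = 0
      rw [h1, map_zero]
  have hEVW : EV R n (QuotSMulTop a M ⧸ U.map f) := by
    rw [← hker]
    exact hEVn.congr (g.quotKerEquivOfSurjective hg).symm
  have hdM' : supportDim R (QuotSMulTop a M) = (n : WithBot ℕ∞) := by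
    apply le_antisymm had
    rw [← hdQ]
    exact supportDim_le_of_surjective g hg
  have hUn : supportDim R U ≤ (n : WithBot ℕ∞) := by
    push_cast at hU
    exact ENat.WithBot.lt_add_one_iff.mp hU
  have hHU : H0sub R M ≤ U := hleU _ (((le_H0_iff _).mp le_rfl).trans_lt hpos)
  rcases Nat.eq_zero_or_pos n with rfl | hn
  · have h1 : U = H0sub R M := le_antisymm ((le_H0_iff U).mpr (by exact_mod_cast hUn)) hHU
    have h2 : (⊤ : Submodule R (QuotSMulTop a M)) = H0sub R _ := by
      refine (top_le_iff.mp ((le_H0_iff _).mpr ?_)).symm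
      rw [sdim_top, hdM']; exact le_of_eq Nat.cast_zero
    rw [h1, h2]
    exact ⟨fun _ => SC.base, fun _ => SC.base⟩
  · exact core hf hn hHU hEVW hdM' hUn
end
end SCM



/-- For a parameter element `x ∈ b(M)^3`, `M` is sequentially Cohen-Macaulay
iff `M/xM` is sequentially Cohen-Macaulay and `M/D_{t-1}` is Cohen-Macaulay, where `D_{t-1}`
is the largest submodule of `M = D_t` of strictly smaller dimension (the penultimate member of
the dimension filtration `D_0 ⊆ D_1 ⊆ ⋯ ⊆ D_t = M`). -/
theorem stmt4 (R : Type u) [CommRing R] [IsLocalRing R] [IsNoetherianRing R]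
    (hCM : IsQuotientOfCMLocalRing R)
    (M : Type u) [AddCommGroup M] [Module R M] [Module.Finite R M]
    (d : ℕ) (hd : 0 < d) (hdim : mdim R M = d)
    (a : R) (ha : a ∈ (bIdeal R M d) ^ 3) (hpe : IsParamElement R M d a) :
    IsSeqCM R M ↔
      IsSeqCM R (M ⧸ (Ideal.span {a} • ⊤ : Submodule R M)) ∧
        IsCM R (M ⧸ unmixedComp R M) := by
  obtain ⟨n, rfl⟩ : ∃ n, d = n + 1 := ⟨d - 1, by omega⟩
  rw [SCM.isSeqCM_iff, SCM.isSeqCM_iff]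
  exact SCM.main ((SCM.mdim_eq_nat_iff M (n+1)).mp hdim)
    (Ideal.pow_le_self (by norm_num) ha) hpe
end

section
/- Let x_1, ..., x_d be a C-system of parameters of M. Then there is a surjective k-linear map from Soc(M/(x_1,...,x_d)M) onto Soc(H^d_m(M)); in particular dim_k Soc(H^d_m(M)) ≤ ir_M((x_1,...,x_d)). -/
open IsLocalRing

universe u

open Paper IsLocalRing

namespace LC
open CategoryTheory Abelian

variable {R : Type u} [CommRing R]

/-- The cyclic module `R/J^n` as an object. -/
noncomputable abbrev Q (J : Ideal R) (n : ℕ) : ModuleCat.{u} R := ModuleCat.of R (R ⧸ J ^ n)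

/-- Transition maps `R/J^m → R/J^n` for `n ≤ m`. -/
noncomputable def tr (J : Ideal R) {n m : ℕ} (h : n ≤ m) : Q J m ⟶ Q J n :=
  ModuleCat.ofHom (Submodule.mapQ _ _ LinearMap.id (Ideal.pow_le_pow_right h))

lemma tr_refl (J : Ideal R) (n : ℕ) : tr J (le_refl n) = 𝟙 _ := by
  refine ModuleCat.hom_ext (LinearMap.ext fun x => ?_)
  obtain ⟨x, rfl⟩ := Submodule.Quotient.mk_surjective _ x
  rfl

lemma tr_tr (J : Ideal R) {a b c : ℕ} (h : a ≤ b) (h' : b ≤ c) :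
    tr J h' ≫ tr J h = tr J (h.trans h') := by
  refine ModuleCat.hom_ext (LinearMap.ext fun x => ?_)
  obtain ⟨x, rfl⟩ := Submodule.Quotient.mk_surjective _ x
  rfl

/-- The transition maps on Ext. -/
noncomputable def exTr (J : Ideal R) (i : ℕ) (N : Type u) [AddCommGroup N] [Module R N]
    (n m : ℕ) (h : n ≤ m) : Ext (Q J n) (ModuleCat.of R N) i →ₗ[R] Ext (Q J m) (ModuleCat.of R N) i :=
  Ext.precompOfLinear (Ext.mk₀ (tr J h)) R _ (zero_add i)

lemma exTr_apply (J : Ideal R) (i : ℕ) (N : Type u) [AddCommGroup N] [Module R N]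
    (n m : ℕ) (h : n ≤ m) (ξ) : exTr J i N n m h ξ = (Ext.mk₀ (tr J h)).comp ξ (zero_add i) := rfl

instance (J : Ideal R) (i : ℕ) (N : Type u) [AddCommGroup N] [Module R N] :
    DirectedSystem (fun n => Ext (Q J n) (ModuleCat.of R N) i) (fun n m h => exTr J i N n m h) where
  map_self n x := by
    rw [exTr_apply, tr_refl, Ext.mk₀_id_comp]
  map_map k j i hij hjk x := by
    simp only [exTr_apply, Ext.mk₀_comp_mk₀_assoc, tr_tr]

/-- Local cohomology as a direct limit of Ext modules. -/
noncomputable def H (J : Ideal R) (i : ℕ) (N : Type u) [AddCommGroup N] [Module R N] : Type u :=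
  Module.DirectLimit (fun n => Ext (Q J n) (ModuleCat.of R N) i) (exTr J i N)

section
variable (J : Ideal R) (i : ℕ) (N : Type u) [AddCommGroup N] [Module R N]

noncomputable instance : AddCommGroup (H J i N) :=
  inferInstanceAs (AddCommGroup (Module.DirectLimit _ (exTr J i N)))
noncomputable instance : Module R (H J i N) :=
  inferInstanceAs (Module R (Module.DirectLimit _ (exTr J i N)))

/-- canonical map. -/
noncomputable def Hof (n : ℕ) : Ext (Q J n) (ModuleCat.of R N) i →ₗ[R] H J i N :=
  Module.DirectLimit.of R ℕ _ (exTr J i N) n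

variable {J i N}

lemma H_rep (ξ : H J i N) : ∃ n x, Hof J i N n x = ξ := Module.DirectLimit.exists_of ξ

lemma Hof_tr {n m : ℕ} (h : n ≤ m) (x) : Hof J i N m ((Ext.mk₀ (tr J h)).comp x (zero_add i)) = Hof J i N n x :=
  Module.DirectLimit.of_f (hij := h)

lemma Hof_zero {n : ℕ} {x} (h : Hof J i N n x = 0) :
    ∃ m, ∃ h : n ≤ m, (Ext.mk₀ (tr J h)).comp x (zero_add i) = 0 := by
  obtain ⟨m, hm, h⟩ := Module.DirectLimit.of.zero_exact h
  exact ⟨m, hm, h⟩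

/-- universal property. -/
noncomputable def Hlift {P : Type*} [AddCommGroup P] [Module R P]
    (g : ∀ n, Ext (Q J n) (ModuleCat.of R N) i →ₗ[R] P)
    (hg : ∀ n m (h : n ≤ m) x, g m ((Ext.mk₀ (tr J h)).comp x (zero_add i)) = g n x) : H J i N →ₗ[R] P :=
  Module.DirectLimit.lift R ℕ _ (exTr J i N) g hg

lemma Hlift_of {P : Type*} [AddCommGroup P] [Module R P]
    (g : ∀ n, Ext (Q J n) (ModuleCat.of R N) i →ₗ[R] P)
    (hg : ∀ n m (h : n ≤ m) x, g m ((Ext.mk₀ (tr J h)).comp x (zero_add i)) = g n x) (n x) :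
    Hlift g hg (Hof J i N n x) = g n x :=
  Module.DirectLimit.lift_of _ _ _

variable {N' N'' : Type u} [AddCommGroup N'] [Module R N'] [AddCommGroup N''] [Module R N'']

/-- action of an Ext class. -/
noncomputable def Hcomp (J : Ideal R) {j k : ℕ} (α : Ext (ModuleCat.of R N) (ModuleCat.of R N') j) (h : i + j = k) :
    H J i N →ₗ[R] H J k N' :=
  Hlift (fun n => (Hof J k N' n) ∘ₗ Ext.postcompOfLinear α R _ h) (by
    intro n m hnm x
    simp only [LinearMap.comp_apply, LinearMap.flip_apply, Ext.bilinearCompOfLinear_apply_apply]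
    rw [Ext.comp_assoc (h₂₃ := h) (h := by omega), Hof_tr])

lemma Hcomp_of {j k : ℕ} (α : Ext (ModuleCat.of R N) (ModuleCat.of R N') j) (h : i + j = k) (n x) :
    Hcomp J α h (Hof J i N n x) = Hof J k N' n (x.comp α h) := Hlift_of _ _ _ _

/-- functoriality. -/
noncomputable def Hmap (J : Ideal R) (i : ℕ) (f : N →ₗ[R] N') : H J i N →ₗ[R] H J i N' :=
  Hcomp J (Ext.mk₀ (ModuleCat.ofHom f)) (add_zero i)

lemma Hmap_of (f : N →ₗ[R] N') (n x) :
    Hmap J i f (Hof J i N n x) = Hof J i N' n (x.comp (Ext.mk₀ (ModuleCat.ofHom f)) (add_zero i)) :=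
  Hcomp_of _ _ _ _

lemma Hmap_comp (f : N →ₗ[R] N') (g : N' →ₗ[R] N'') (ξ : H J i N) :
    Hmap J i g (Hmap J i f ξ) = Hmap J i (g ∘ₗ f) ξ := by
  obtain ⟨n, x, rfl⟩ := H_rep ξ
  simp only [Hmap_of, Ext.comp_assoc_of_third_deg_zero, Ext.mk₀_comp_mk₀, ModuleCat.ofHom_comp]

lemma Hmap_smul (r : R) (f : N →ₗ[R] N') (ξ : H J i N) : Hmap J i (r • f) ξ = r • Hmap J i f ξ := by
  obtain ⟨n, x, rfl⟩ := H_rep ξ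
  have : ModuleCat.ofHom (r • f) = r • ModuleCat.ofHom f := rfl
  rw [Hmap_of, Hmap_of, this, Ext.mk₀_smul, Ext.comp_smul, map_smul]

lemma Hmap_id (ξ : H J i N) : Hmap J i (LinearMap.id : N →ₗ[R] N) ξ = ξ := by
  obtain ⟨n, x, rfl⟩ := H_rep ξ
  rw [Hmap_of, ModuleCat.ofHom_id, Ext.comp_mk₀_id]

lemma Hmap_zero (ξ : H J i N) : Hmap J i (0 : N →ₗ[R] N') ξ = 0 := by
  have := Hmap_smul (0 : R) (0 : N →ₗ[R] N') ξ
  rwa [zero_smul, zero_smul] at this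

lemma Hmap_add (f g : N →ₗ[R] N') (ξ : H J i N) : Hmap J i (f + g) ξ = Hmap J i f ξ + Hmap J i g ξ := by
  obtain ⟨n, x, rfl⟩ := H_rep ξ
  have : ModuleCat.ofHom (f + g) = ModuleCat.ofHom f + ModuleCat.ofHom g := rfl
  rw [Hmap_of, Hmap_of, Hmap_of, this, Ext.mk₀_add, Ext.comp_add, map_add]

lemma Hmap_sum {ι : Type*} (s : Finset ι) (f : ι → (N →ₗ[R] N')) (ξ : H J i N) :
    Hmap J i (∑ k ∈ s, f k) ξ = ∑ k ∈ s, Hmap J i (f k) ξ := by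
  classical
  induction s using Finset.induction_on with
  | empty => simp [Hmap_zero]
  | insert a s ha ih => rw [Finset.sum_insert ha, Finset.sum_insert ha, Hmap_add, ih]

lemma Hmap_lsmul (r : R) (ξ : H J i N) : Hmap J i (LinearMap.lsmul R N r) ξ = r • ξ := by
  have : LinearMap.lsmul R N r = r • LinearMap.id := by ext; simp
  rw [this, Hmap_smul, Hmap_id]

lemma H_torsion (ξ : H J i N) : ∃ n, ∀ r ∈ J ^ n, r • ξ = 0 := by
  obtain ⟨n, x, rfl⟩ := H_rep ξ
  refine ⟨n, fun r hr => ?_⟩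
  have h0 : r • (𝟙 (Q J n)) = 0 := by
    refine ModuleCat.hom_ext (LinearMap.ext fun y => ?_)
    obtain ⟨y, rfl⟩ := Submodule.Quotient.mk_surjective _ y
    change r • (Submodule.Quotient.mk y : R ⧸ J ^ n) = 0
    rw [← Submodule.Quotient.mk_smul, Submodule.Quotient.mk_eq_zero]
    exact Ideal.mul_mem_right _ _ hr
  rw [← map_smul, ← Ext.mk₀_id_comp x, ← Ext.smul_comp, ← Ext.mk₀_smul, h0, Ext.mk₀_zero,
    Ext.zero_comp, map_zero]

lemma H_injective_zero (E : Type u) [AddCommGroup E] [Module R E] [Module.Injective R E] (ξ : H J (i+1) E) : ξ = 0 := by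
  obtain ⟨n, x, rfl⟩ := H_rep ξ
  have : Injective (ModuleCat.of R E) := Module.injective_object_of_injective_module R E
  rw [Ext.eq_zero_of_injective x, map_zero]

/-! Long exact sequence -/

lemma sexact {f : N →ₗ[R] N'} {g : N' →ₗ[R] N''} (hf : Function.Injective f)
    (hfg : Function.Exact f g) (hg : Function.Surjective g) :
    (ShortComplex.mk (ModuleCat.ofHom f) (ModuleCat.ofHom g)
      (by ext x; exact hfg.apply_apply_eq_zero x)).ShortExact where
  exact := (ShortComplex.ShortExact.moduleCat_exact_iff_function_exact _).2 hfg
  mono_f := (ModuleCat.mono_iff_injective _).2 hf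
  epi_g := (ModuleCat.epi_iff_surjective _).2 hg

/-- connecting map -/
noncomputable def Hδ (J : Ideal R) (i : ℕ) {f : N →ₗ[R] N'} {g : N' →ₗ[R] N''} (hf : Function.Injective f)
    (hfg : Function.Exact f g) (hg : Function.Surjective g) : H J i N'' →ₗ[R] H J (i+1) N :=
  Hcomp J (sexact hf hfg hg).extClass rfl

section
variable {f : N →ₗ[R] N'} {g : N' →ₗ[R] N''} (hf : Function.Injective f)
    (hfg : Function.Exact f g) (hg : Function.Surjective g)
include hf hfg hg

lemma H_exact₂ (ξ : H J i N') (h : Hmap J i g ξ = 0) : ∃ η, Hmap J i f η = ξ := by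
  obtain ⟨n, x, rfl⟩ := H_rep ξ
  rw [Hmap_of] at h
  obtain ⟨m, hm, h⟩ := Hof_zero h
  rw [← Ext.comp_assoc_of_third_deg_zero] at h
  obtain ⟨y, hy⟩ := Ext.covariant_sequence_exact₂ _ (sexact hf hfg hg) _ h
  refine ⟨Hof J i N m y, ?_⟩
  rw [Hmap_of, ← Hof_tr hm, ← hy]

lemma H_exact₃ (ξ : H J i N'') (h : Hδ J i hf hfg hg ξ = 0) : ∃ η, Hmap J i g η = ξ := by
  obtain ⟨n, x, rfl⟩ := H_rep ξ
  rw [Hδ, Hcomp_of] at h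
  obtain ⟨m, hm, h⟩ := Hof_zero h
  rw [← Ext.comp_assoc (h₁₂ := zero_add i) (h := by omega)] at h
  obtain ⟨y, hy⟩ := Ext.covariant_sequence_exact₃ _ (sexact hf hfg hg) _ rfl h
  refine ⟨Hof J i N' m y, ?_⟩
  rw [Hmap_of, ← Hof_tr hm, ← hy]

lemma H_exact₁ (ξ : H J (i+1) N) (h : Hmap J (i+1) f ξ = 0) : ∃ η, Hδ J i hf hfg hg η = ξ := by
  obtain ⟨n, x, rfl⟩ := H_rep ξ
  rw [Hmap_of] at h
  obtain ⟨m, hm, h⟩ := Hof_zero h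
  rw [← Ext.comp_assoc_of_third_deg_zero] at h
  obtain ⟨y, hy⟩ := Ext.covariant_sequence_exact₁ _ (sexact hf hfg hg) _ h rfl
  refine ⟨Hof J i N'' m y, ?_⟩
  rw [Hδ, Hcomp_of, ← Hof_tr hm, ← hy]
end

lemma Hδ_nat {f : N →ₗ[R] N'} {g : N' →ₗ[R] N''} (hf : Function.Injective f)
    (hfg : Function.Exact f g) (hg : Function.Surjective g)
    {K' K'' : Type u} [AddCommGroup K'] [Module R K'] [AddCommGroup K''] [Module R K'']
    {f' : N →ₗ[R] K'} {g' : K' →ₗ[R] K''} (hf' : Function.Injective f')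
    (hfg' : Function.Exact f' g') (hg' : Function.Surjective g')
    (b : N' →ₗ[R] K') (c : N'' →ₗ[R] K'') (h1 : b ∘ₗ f = f') (h2 : c ∘ₗ g = g' ∘ₗ b)
    (ξ : H J i N'') : Hδ J i hf' hfg' hg' (Hmap J i c ξ) = Hδ J i hf hfg hg ξ := by
  obtain ⟨n, x, rfl⟩ := H_rep ξ
  have key := ShortComplex.ShortExact.extClass_naturality (sexact hf hfg hg) (sexact hf' hfg' hg')
    { τ₁ := 𝟙 _, τ₂ := ModuleCat.ofHom b, τ₃ := ModuleCat.ofHom c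
      comm₁₂ := by ext x; exact (LinearMap.congr_fun h1 x).symm
      comm₂₃ := by ext x; exact (LinearMap.congr_fun h2 x).symm }
  have key2 : (sexact hf hfg hg).extClass =
      (Ext.mk₀ (ModuleCat.ofHom c)).comp (sexact hf' hfg' hg').extClass (zero_add 1) :=
    (Ext.comp_mk₀_id _).symm.trans key
  rw [Hmap_of]
  unfold Hδ
  rw [Hcomp_of, Hcomp_of, key2]
  rw [Ext.comp_assoc_of_second_deg_zero]

/-! degree zero -/

/-- evaluation at one, at a finite stage. -/
noncomputable def ev1 (J : Ideal R) (N : Type u) [AddCommGroup N] [Module R N] (n : ℕ) :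
    Ext (Q J n) (ModuleCat.of R N) 0 →ₗ[R] N where
  toFun x := (Ext.linearEquiv₀ (R := R) x).hom (1 : R ⧸ J ^ n)
  map_add' := by intros; simp
  map_smul' := by intros; simp

lemma ev1_mk (n : ℕ) (f : Q J n ⟶ ModuleCat.of R N) : ev1 J N n (Ext.mk₀ f) = f.hom (1 : R ⧸ J ^ n) := by
  have : Ext.linearEquiv₀ (R := R) (Ext.mk₀ f) = f := (Ext.linearEquiv₀ (R := R)).apply_symm_apply f
  simp [ev1, this]

lemma Ext0_rep (n : ℕ) (x : Ext (Q J n) (ModuleCat.of R N) 0) : ∃ f, x = Ext.mk₀ f :=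
  ⟨_, (Ext.mk₀_homEquiv₀_apply x).symm⟩

/-- evaluation at one. -/
noncomputable def H0ev (J : Ideal R) (N : Type u) [AddCommGroup N] [Module R N] : H J 0 N →ₗ[R] N :=
  Hlift (ev1 J N) (by
    intro n m h x
    obtain ⟨x, rfl⟩ := Ext0_rep n x
    rw [Ext.mk₀_comp_mk₀, ev1_mk, ev1_mk]
    rfl)

lemma H0ev_of (n x) : H0ev J N (Hof J 0 N n x) = ev1 J N n x := Hlift_of _ _ _ _

lemma H0ev_injective : Function.Injective (H0ev J N) := by
  rw [injective_iff_map_eq_zero]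
  intro ξ h
  obtain ⟨n, x, rfl⟩ := H_rep ξ
  obtain ⟨f, rfl⟩ := Ext0_rep n x
  rw [H0ev_of, ev1_mk] at h
  have : f = 0 := by
    refine ModuleCat.hom_ext (LinearMap.ext fun y => ?_)
    obtain ⟨y, rfl⟩ := Submodule.Quotient.mk_surjective _ y
    have e : (Submodule.Quotient.mk y : R ⧸ J ^ n) = y • (1 : R ⧸ J ^ n) := by
      rw [Algebra.smul_def, mul_one]; rfl
    rw [e, map_smul, h, smul_zero]; rfl
  rw [this, Ext.mk₀_zero, map_zero]

lemma H0ev_nat (f : N →ₗ[R] N') (ξ : H J 0 N) : H0ev J N' (Hmap J 0 f ξ) = f (H0ev J N ξ) := by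
  obtain ⟨n, x, rfl⟩ := H_rep ξ
  obtain ⟨x, rfl⟩ := Ext0_rep n x
  rw [Hmap_of, H0ev_of, H0ev_of, Ext.mk₀_comp_mk₀, ev1_mk, ev1_mk]
  rfl

lemma H0ev_surj (v : N) (n : ℕ) (h : ∀ r ∈ J ^ n, r • v = 0) : ∃ ξ, H0ev J N ξ = v := by
  refine ⟨Hof J 0 N n (Ext.mk₀ (ModuleCat.ofHom (Submodule.liftQ (J ^ n) (LinearMap.toSpanSingleton R N v) (by
    intro r hr; simpa using h r hr)))), ?_⟩
  rw [H0ev_of, ev1_mk]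
  change (LinearMap.toSpanSingleton R N v) 1 = v
  simp

end
end LC

namespace LC
open CategoryTheory Abelian

variable {R : Type u} [CommRing R]

/-- `J`-power torsion modules. -/
def Tors (J : Ideal R) (N : Type u) [AddCommGroup N] [Module R N] : Prop :=
  ∀ v : N, ∃ n : ℕ, ∀ r ∈ J ^ n, r • v = 0

lemma pow_kill {J : Ideal R} {N : Type u} [AddCommGroup N] [Module R N] {v : N} {n m : ℕ}
    (h : ∀ r ∈ J ^ n, r • v = 0) (hnm : n ≤ m) : ∀ r ∈ J ^ m, r • v = 0 :=
  fun r hr => h r (Ideal.pow_le_pow_right hnm hr)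

/-- The `J`-power torsion submodule. -/
def Gam (J : Ideal R) (E : Type u) [AddCommGroup E] [Module R E] : Submodule R E where
  carrier := {v | ∃ n : ℕ, ∀ r ∈ J ^ n, r • v = 0}
  zero_mem' := ⟨0, by simp⟩
  add_mem' := by
    rintro a b ⟨n, hn⟩ ⟨m, hm⟩
    refine ⟨max n m, fun r hr => ?_⟩
    rw [smul_add, pow_kill hn (le_max_left _ _) r hr, pow_kill hm (le_max_right _ _) r hr, add_zero]
  smul_mem' := by
    rintro c a ⟨n, hn⟩
    refine ⟨n, fun r hr => ?_⟩
    rw [smul_comm, hn r hr, smul_zero]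

lemma Gam_tors (J : Ideal R) (E : Type u) [AddCommGroup E] [Module R E] : Tors J (Gam J E) := by
  rintro ⟨v, n, hn⟩
  exact ⟨n, fun r hr => Subtype.ext (hn r hr)⟩

lemma Tors.of_surj {J : Ideal R} {N N' : Type u} [AddCommGroup N] [Module R N] [AddCommGroup N'] [Module R N']
    (h : Tors J N) (f : N →ₗ[R] N') (hf : Function.Surjective f) : Tors J N' := by
  intro v
  obtain ⟨w, rfl⟩ := hf v
  obtain ⟨n, hn⟩ := h w
  exact ⟨n, fun r hr => by rw [← map_smul, hn r hr, map_zero]⟩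

lemma Tors.bdd {J : Ideal R} {N : Type u} [AddCommGroup N] [Module R N] [Module.Finite R N]
    (h : Tors J N) : ∃ n : ℕ, ∀ r ∈ J ^ n, ∀ v : N, r • v = 0 := by
  classical
  obtain ⟨s, hs⟩ := Module.Finite.fg_top (R := R) (M := N)
  choose n hn using h
  refine ⟨s.sup n, fun r hr v => ?_⟩
  have hv : v ∈ Submodule.span R (s : Set N) := hs ▸ trivial
  induction hv using Submodule.span_induction with
  | mem x hx => exact pow_kill (hn x) (Finset.le_sup hx) r hr
  | zero => simp
  | add x y _ _ hx hy => rw [smul_add, hx, hy, add_zero]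
  | smul a x _ hx => rw [smul_comm, hx, smul_zero]

lemma Gam_injective [IsNoetherianRing R] (J : Ideal R) (E : Type u) [AddCommGroup E] [Module R E]
    [Module.Injective R E] : Module.Injective R (Gam J E) := by
  apply Module.Baer.injective
  intro I g
  obtain ⟨k, hk⟩ : ∃ k, ∀ r ∈ J ^ k, ∀ v : LinearMap.range g, r • v = 0 := by
    refine Tors.bdd (N := LinearMap.range g) (J := J) ?_
    rintro ⟨v, -⟩
    obtain ⟨n, hn⟩ := Gam_tors J E v
    exact ⟨n, fun r hr => Subtype.ext (hn r hr)⟩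
  obtain ⟨c, hc⟩ := Ideal.exists_pow_inf_eq_pow_smul J (M := R) I
  have h1 := hc (k + c) (by omega)
  let f : I →ₗ[R] E := (Gam J E).subtype ∘ₗ g
  have hf : Submodule.comap I.subtype (J ^ (k + c)) ≤ LinearMap.ker f := by
    rintro ⟨a, ha⟩ haJ
    have haJ' : a ∈ J ^ (k + c) := haJ
    have h2 : a ∈ J ^ (k + c) • (⊤ : Submodule R R) ⊓ I := ⟨by simpa using haJ', ha⟩
    rw [h1, Nat.add_sub_cancel] at h2
    have h3 : a ∈ J ^ k • I := Submodule.smul_mono le_rfl inf_le_right h2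
    have h4 : ∀ b ∈ J ^ k • I, ∃ hb : b ∈ I, f ⟨b, hb⟩ = 0 := by
      intro b hb
      refine Submodule.smul_induction_on hb ?_ ?_
      · intro r hr x hx
        refine ⟨Ideal.mul_mem_left _ _ hx, ?_⟩
        have e : (⟨r • x, Ideal.mul_mem_left _ _ hx⟩ : I) = r • ⟨x, hx⟩ := rfl
        rw [e, map_smul]
        have := congrArg Subtype.val (congrArg Subtype.val (hk r hr ⟨g ⟨x, hx⟩, ⟨_, rfl⟩⟩))
        exact this
      · rintro x y ⟨hxI, hx⟩ ⟨hyI, hy⟩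
        refine ⟨add_mem hxI hyI, ?_⟩
        have e : (⟨x + y, add_mem hxI hyI⟩ : I) = ⟨x, hxI⟩ + ⟨y, hyI⟩ := rfl
        rw [e, map_add, hx, hy, add_zero]
    exact (h4 a h3).2
  let X := I ⧸ Submodule.comap I.subtype (J ^ (k + c))
  let φ : X →ₗ[R] (R ⧸ J ^ (k + c)) := Submodule.mapQ _ _ I.subtype le_rfl
  have hφ : Function.Injective φ := by
    rw [injective_iff_map_eq_zero]
    intro x hx
    obtain ⟨x, rfl⟩ := Submodule.Quotient.mk_surjective _ x
    have hx' : (Submodule.Quotient.mk (x : R) : R ⧸ J ^ (k + c)) = 0 := hx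
    have hx2 : (x : R) ∈ J ^ (k + c) := (Submodule.Quotient.mk_eq_zero _).1 hx'
    exact (Submodule.Quotient.mk_eq_zero _).2 hx2
  obtain ⟨h, hh⟩ := Module.Injective.out φ hφ (Submodule.liftQ _ f hf)
  have hm : ∀ r : R, h (Submodule.Quotient.mk r) ∈ Gam J E := by
    intro r
    refine ⟨k + c, fun s hs => ?_⟩
    rw [← map_smul, ← Submodule.Quotient.mk_smul,
      (Submodule.Quotient.mk_eq_zero _).2 (show s • r ∈ _ from Ideal.mul_mem_right _ _ hs), map_zero]
  refine ⟨LinearMap.codRestrict (Gam J E) (h ∘ₗ Submodule.mkQ _) hm, fun a ha => ?_⟩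
  apply Subtype.ext
  exact hh (Submodule.Quotient.mk ⟨a, ha⟩)

section
variable {J : Ideal R} {i : ℕ} {N N' N'' : Type u} [AddCommGroup N] [Module R N]
  [AddCommGroup N'] [Module R N'] [AddCommGroup N''] [Module R N'']
  {f : N →ₗ[R] N'} {g : N' →ₗ[R] N''} (hf : Function.Injective f)
    (hfg : Function.Exact f g) (hg : Function.Surjective g)

lemma Hδ_map (ξ : H J i N') : Hδ J i hf hfg hg (Hmap J i g ξ) = 0 := by
  obtain ⟨n, x, rfl⟩ := H_rep ξ
  rw [Hmap_of]
  unfold Hδ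
  rw [Hcomp_of, Ext.comp_assoc_of_second_deg_zero]
  erw [(sexact hf hfg hg).comp_extClass]
  rw [Ext.comp_zero, map_zero]

lemma Hmap_δ (ξ : H J i N'') : Hmap J (i+1) f (Hδ J i hf hfg hg ξ) = 0 := by
  obtain ⟨n, x, rfl⟩ := H_rep ξ
  unfold Hδ
  rw [Hcomp_of, Hmap_of, Ext.comp_assoc_of_third_deg_zero]
  erw [(sexact hf hfg hg).extClass_comp]
  rw [Ext.comp_zero, map_zero]
end

lemma H_tors_zero [IsNoetherianRing R] (J : Ideal R) (i : ℕ) : ∀ (N : Type u) [AddCommGroup N] [Module R N]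
    (_ : Tors J N) (ξ : H J (i+1) N), ξ = 0 := by
  have key : ∀ (N : Type u) [AddCommGroup N] [Module R N] (_ : Tors J N),
      ∃ (G : Type u) (_ : AddCommGroup G) (_ : Module R G) (_ : Module.Injective R G) (_ : Tors J G)
        (f : N →ₗ[R] G), Function.Injective f := by
    intro N _ _ hN
    let E := Injective.under (ModuleCat.of R N)
    have hE : Injective (ModuleCat.of R E) := inferInstanceAs (Injective (Injective.under (ModuleCat.of R N)))
    have : Module.Injective R E := Module.injective_module_of_injective_object R E
    let ι : N →ₗ[R] E := (Injective.ι (ModuleCat.of R N)).hom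
    have hι : Function.Injective ι := (ModuleCat.mono_iff_injective _).1 inferInstance
    refine ⟨Gam J E, inferInstance, inferInstance, Gam_injective J E, Gam_tors J E,
      LinearMap.codRestrict _ ι ?_, ?_⟩
    · intro v
      obtain ⟨n, hn⟩ := hN v
      exact ⟨n, fun r hr => by rw [← map_smul, hn r hr, map_zero]⟩
    · intro a b hab
      exact hι (congrArg Subtype.val hab)
  induction i with
  | zero =>
    intro N _ _ hN ξ
    obtain ⟨G, _, _, _, hG, f, hf⟩ := key N hN
    obtain ⟨η, rfl⟩ := H_exact₁ hf (LinearMap.exact_map_mkQ_range f) (Submodule.mkQ_surjective _) ξ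
      (H_injective_zero _ _)
    obtain ⟨v, hv⟩ := Submodule.mkQ_surjective _ (H0ev J _ η)
    obtain ⟨n, hn⟩ := hG v
    obtain ⟨θ, hθ⟩ := H0ev_surj v n hn
    have : Hmap J 0 (LinearMap.range f).mkQ θ = η := H0ev_injective (by rw [H0ev_nat, hθ, hv])
    rw [← this, Hδ_map]
  | succ i ih =>
    intro N _ _ hN ξ
    obtain ⟨G, _, _, _, hG, f, hf⟩ := key N hN
    obtain ⟨η, rfl⟩ := H_exact₁ hf (LinearMap.exact_map_mkQ_range f) (Submodule.mkQ_surjective _) ξ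
      (H_injective_zero _ _)
    rw [ih _ (hG.of_surj _ (Submodule.mkQ_surjective _)) η, map_zero]

/-- The common lemma. -/
lemma lemL {J : Ideal R} {i : ℕ} {N Q' : Type u} [AddCommGroup N] [Module R N] [AddCommGroup Q'] [Module R Q']
    (y b : R) (g : N →ₗ[R] Q') (hg : Function.Surjective g)
    (hk : LinearMap.ker g = LinearMap.range (LinearMap.lsmul R N y))
    (h0 : ∀ ξ : H J (i+1) (LinearMap.ker (LinearMap.lsmul R N y)), ξ = 0)
    (hb : ∀ η : H J i Q', b • η = 0) (ξ : H J (i+1) N) (hξ : y • ξ = 0) : b • ξ = 0 := by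
  let u := LinearMap.lsmul R N y
  have hfg : Function.Exact (LinearMap.range u).subtype g := by
    intro v
    rw [← LinearMap.mem_ker, hk]; simp [u]
  have e1 : (LinearMap.range u).subtype ∘ₗ u.rangeRestrict = u := by ext; rfl
  have h1 : Hmap J (i+1) (LinearMap.range u).subtype (Hmap J (i+1) u.rangeRestrict ξ) = 0 := by
    rw [Hmap_comp, e1, Hmap_lsmul, hξ]
  obtain ⟨η, hη⟩ := H_exact₁ (Submodule.subtype_injective _) hfg hg _ h1
  have h2 : Hmap J (i+1) u.rangeRestrict (b • ξ) = 0 := by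
    rw [map_smul, ← hη, ← map_smul, hb, map_zero]
  have hfg2 : Function.Exact (LinearMap.ker u).subtype u.rangeRestrict := by
    intro v
    rw [← LinearMap.mem_ker, LinearMap.ker_rangeRestrict]; simp
  obtain ⟨θ, hθ⟩ := H_exact₂ (Submodule.subtype_injective _) hfg2 u.surjective_rangeRestrict _ h2
  rw [← hθ, h0 θ, map_zero]
end LC

namespace LC
open CategoryTheory Abelian

variable {R : Type u} [CommRing R]

lemma le_rad_pow [IsNoetherianRing R] {J I : Ideal R} (h : J ≤ I.radical) : ∃ n, J ^ n ≤ I :=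
  Ideal.exists_pow_le_of_le_radical_of_fg h (IsNoetherian.noetherian J)

lemma H_vanish [IsNoetherianRing R] (J : Ideal R) (l : List R) (hl : ∀ a ∈ l, a ∈ J) :
    ∀ (i : ℕ) (N : Type u) [AddCommGroup N] [Module R N] [Module.Finite R N]
    (_ : J ≤ (Module.annihilator R N ⊔ Ideal.ofList l).radical) (_ : l.length < i) (ξ : H J i N), ξ = 0 := by
  induction l with
  | nil =>
    intro i N _ _ _ hN hi ξ
    obtain ⟨i, rfl⟩ : ∃ k, i = k + 1 := ⟨i - 1, by simp at hi; omega⟩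
    rw [Ideal.ofList_nil, sup_bot_eq] at hN
    obtain ⟨n, hn⟩ := le_rad_pow hN
    exact H_tors_zero J i N (fun v => ⟨n, fun r hr => Module.mem_annihilator.1 (hn hr) v⟩) ξ
  | cons a l ih =>
    intro i N _ _ _ hN hi ξ
    obtain ⟨i, rfl⟩ : ∃ k, i = k + 1 := ⟨i - 1, by simp at hi; omega⟩
    simp only [List.length_cons] at hi
    have ih := ih (fun a ha => hl a (by simp [ha]))
    obtain ⟨n, hn⟩ := H_torsion ξ
    have haξ : a ^ n • ξ = 0 := hn _ (Ideal.pow_mem_pow (hl a (by simp)) n)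
    have hK : ∀ (K : Type u) [AddCommGroup K] [Module R K],
        Module.annihilator R N ≤ Module.annihilator R K → a ^ n ∈ Module.annihilator R K →
        J ≤ (Module.annihilator R K ⊔ Ideal.ofList l).radical := by
      intro K _ _ h1 h2
      refine hN.trans (Ideal.radical_le_radical_iff.2 ?_)
      rw [Ideal.ofList_cons]
      refine sup_le ?_ (sup_le ?_ ?_)
      · exact (h1.trans le_sup_left).trans Ideal.le_radical
      · rw [Ideal.span_singleton_le_iff_mem]
        exact ⟨n, Ideal.mem_sup_left h2⟩
      · exact le_sup_right.trans Ideal.le_radical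
    have := lemL (J := J) (i := i) (a ^ n) 1 (Submodule.mkQ (LinearMap.range (LinearMap.lsmul R N (a ^ n))))
      (Submodule.mkQ_surjective _) (Submodule.ker_mkQ _) ?_ ?_ ξ haξ
    · rwa [one_smul] at this
    · refine ih _ _ (hK _ ?_ ?_) (by omega)
      · exact LinearMap.annihilator_le_of_injective _ (Submodule.subtype_injective _)
      · rw [Module.mem_annihilator]
        rintro ⟨v, hv⟩
        exact Subtype.ext hv
    · intro η
      rw [one_smul]
      refine ih _ _ (hK _ ?_ ?_) (by omega) η
      · exact LinearMap.annihilator_le_of_surjective _ (Submodule.mkQ_surjective _)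
      · rw [Module.mem_annihilator]
        intro v
        obtain ⟨v, rfl⟩ := Submodule.mkQ_surjective _ v
        rw [← map_smul, Submodule.mkQ_apply, Submodule.Quotient.mk_eq_zero]
        exact ⟨v, rfl⟩

variable [IsLocalRing R] [IsNoetherianRing R]

lemma finlen_pow {N : Type u} [AddCommGroup N] [Module R N] (h : IsFiniteLength R N) :
    ∃ n, maximalIdeal R ^ n ≤ Module.annihilator R N := by
  obtain ⟨h1, h2⟩ := isFiniteLength_iff_isNoetherian_isArtinian.1 h
  obtain ⟨n, hn⟩ := IsArtinian.monotone_stabilizes (R := R) (M := N)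
    ⟨fun n => OrderDual.toDual (maximalIdeal R ^ n • (⊤ : Submodule R N)), fun a b hab =>
      Submodule.smul_mono (Ideal.pow_le_pow_right hab) le_rfl⟩
  have h3 : maximalIdeal R ^ n • (⊤ : Submodule R N) = maximalIdeal R ^ (n+1) • (⊤ : Submodule R N) :=
    hn (n+1) (by omega)
  refine ⟨n, ?_⟩
  have h4 : maximalIdeal R ^ n • (⊤ : Submodule R N) = ⊥ := by
    refine Submodule.eq_bot_of_le_smul_of_le_jacobson_bot (maximalIdeal R) _ (IsNoetherian.noetherian _) ?_
      (IsLocalRing.maximalIdeal_le_jacobson _)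
    rw [← mul_smul, ← pow_succ', ← h3]
  rw [← Submodule.annihilator_top]
  exact Submodule.le_annihilator_iff.2 h4

lemma finlen_of_pow {N : Type u} [AddCommGroup N] [Module R N] [Module.Finite R N] {n : ℕ}
    (h : maximalIdeal R ^ n ≤ Module.annihilator R N) : IsFiniteLength R N := by
  rw [isFiniteLength_iff_isNoetherian_isArtinian]
  refine ⟨inferInstance, ?_⟩
  replace h : maximalIdeal R ^ (n+1) ≤ Module.annihilator R N :=
    (Ideal.pow_le_pow_right (Nat.le_succ n)).trans h
  let I := maximalIdeal R ^ (n+1)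
  have : IsArtinianRing (R ⧸ I) := by
    apply IsLocalRing.quotient_artinian_of_mem_minimalPrimes_of_isLocalRing
    refine ⟨⟨inferInstance, Ideal.pow_le_self (by omega)⟩, ?_⟩
    rintro p ⟨hp, hIp⟩ -
    exact hp.le_of_pow_le hIp
  have ht : Module.IsTorsionBySet R N (I : Set R) := by
    intro v r
    exact Module.mem_annihilator.1 (h r.2) v
  letI := ht.module
  haveI : IsScalarTower R (R ⧸ I) N := ht.isScalarTower
  haveI : Module.Finite (R ⧸ I) N := Module.Finite.of_restrictScalars_finite R _ _
  have : IsArtinian (R ⧸ I) N := inferInstance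
  exact isArtinian_of_surjective_algebraMap (R := R ⧸ I) (S := R) (M := N) Ideal.Quotient.mk_surjective

lemma isSOP_iff {M : Type u} [AddCommGroup M] [Module R M] [Module.Finite R M] {d : ℕ} {x : Fin d → R} :
    IsSOP R M d x ↔ (∀ i, x i ∈ maximalIdeal R) ∧
      maximalIdeal R ≤ (Module.annihilator R M ⊔ Ideal.span (Set.range x)).radical := by
  unfold IsSOP
  refine and_congr_right fun hx => ⟨fun h => ?_, fun h => ?_⟩
  · obtain ⟨n, hn⟩ := finlen_pow h
    rw [Ideal.radical_eq_sInf]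
    refine le_sInf ?_
    rintro p ⟨hp1, hp⟩
    have h1 : (⟨p, hp⟩ : PrimeSpectrum R) ∈ Module.support R M ∩ PrimeSpectrum.zeroLocus (Ideal.span (Set.range x)) := by
      rw [Module.support_eq_zeroLocus]
      exact ⟨le_sup_left.trans hp1, le_sup_right.trans hp1⟩
    rw [← Module.support_quotient] at h1
    have := Module.annihilator_le_of_mem_support h1
    exact hp.le_of_pow_le (hn.trans this)
  · obtain ⟨n, hn⟩ := le_rad_pow h
    refine finlen_of_pow (n := n) (hn.trans (sup_le ?_ ?_))
    · exact LinearMap.annihilator_le_of_surjective _ (Submodule.mkQ_surjective _)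
    · intro r hr
      rw [Module.mem_annihilator]
      intro v
      obtain ⟨v, rfl⟩ := Submodule.mkQ_surjective _ v
      rw [← map_smul, Submodule.mkQ_apply, Submodule.Quotient.mk_eq_zero]
      exact Submodule.smul_mem_smul hr trivial

omit [IsLocalRing R] [IsNoetherianRing R] in
/-- coset prime avoidance. -/
lemma avoid (x : R) (I : Ideal R) (S : Finset (Ideal R)) : (∀ p ∈ S, p.IsPrime) →
    (∀ p ∈ S, ¬ (x ∈ p ∧ I ≤ p)) → ∃ w ∈ I, ∀ p ∈ S, x + w ∉ p := by
  classical
  induction S using Finset.strongInduction with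
  | H S ih =>
    intro hS hI
    rcases S.eq_empty_or_nonempty with rfl | hne
    · exact ⟨0, zero_mem _, by simp⟩
    obtain ⟨p, hp⟩ := S.exists_minimal hne
    obtain ⟨w, hw, hw'⟩ := ih (S.erase p) (Finset.erase_ssubset hp.1) (fun q hq => hS q (Finset.mem_of_mem_erase hq))
      (fun q hq => hI q (Finset.mem_of_mem_erase hq))
    by_cases hxw : x + w ∈ p
    · have hp' := hS p hp.1
      have hIp : ¬ I ≤ p := by
        intro h
        exact hI p hp.1 ⟨(Submodule.add_mem_iff_left _ (h hw)).1 hxw, h⟩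
      obtain ⟨c, hc, hcp⟩ := Set.not_subset.1 hIp
      have : ¬ (∏ q ∈ S.erase p, q) ≤ p := by
        rw [hp'.prod_le]
        rintro ⟨q, hq, hqp⟩
        have := hp.2 (Finset.mem_of_mem_erase hq) hqp
        exact Finset.ne_of_mem_erase hq (le_antisymm hqp this)
      obtain ⟨t, ht, htp⟩ := Set.not_subset.1 this
      refine ⟨w + c * t, add_mem hw (Ideal.mul_mem_right _ _ hc), fun q hq => ?_⟩
      rw [← add_assoc]
      by_cases hqp : q = p
      · subst hqp
        intro h
        have := (Submodule.add_mem_iff_right _ hxw).1 h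
        rcases hp'.mem_or_mem this with h | h
        · exact hcp h
        · exact htp h
      · have hq' : q ∈ S.erase p := Finset.mem_erase.2 ⟨hqp, hq⟩
        intro h
        have htq : t ∈ q := (Ideal.prod_le_inf.trans (Finset.inf_le hq') : _ ≤ q) ht
        exact hw' q hq' ((Submodule.add_mem_iff_left _ (Ideal.mul_mem_left _ _ htq)).1 h)
    · refine ⟨w, hw, fun q hq => ?_⟩
      by_cases hqp : q = p
      · subst hqp; exact hxw
      · exact hw' q (Finset.mem_erase.2 ⟨hqp, hq⟩)
end LC

namespace LC
open CategoryTheory Abelian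

variable {R : Type u} [CommRing R]

section
variable {M : Type u} [AddCommGroup M] [Module R M]

lemma factor_ker {A B : Submodule R M} (h : A ≤ B) (y : R)
    (hB : B = A ⊔ Ideal.span {y} • ⊤) :
    LinearMap.ker (Submodule.factor h) = LinearMap.range (LinearMap.lsmul R (M ⧸ A) y) := by
  ext v
  obtain ⟨v, rfl⟩ := Submodule.mkQ_surjective _ v
  rw [LinearMap.mem_ker]
  have e : Submodule.factor h (A.mkQ v) = B.mkQ v := rfl
  rw [e, Submodule.mkQ_apply, Submodule.Quotient.mk_eq_zero, hB]
  constructor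
  · intro hv
    obtain ⟨a, ha, c, hc, rfl⟩ := Submodule.mem_sup.1 hv
    rw [Submodule.ideal_span_singleton_smul] at hc
    obtain ⟨t, -, rfl⟩ := hc
    refine ⟨A.mkQ t, ?_⟩
    rw [map_add, Submodule.mkQ_apply A a, (Submodule.Quotient.mk_eq_zero A).2 ha, zero_add]; rfl
  · rintro ⟨t, ht⟩
    obtain ⟨t, rfl⟩ := Submodule.mkQ_surjective _ t
    have h1 : A.mkQ (v - y • t) = 0 := by
      rw [map_sub, map_smul, ← ht]; simp
    rw [Submodule.mkQ_apply, Submodule.Quotient.mk_eq_zero] at h1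
    have h2 : v = (v - y • t) + y • t := by abel
    rw [h2]
    exact Submodule.add_mem_sup h1 (Submodule.smul_mem_smul (Ideal.mem_span_singleton_self y) trivial)

end

variable [IsLocalRing R] [IsNoetherianRing R] {M : Type u} [AddCommGroup M] [Module R M] [Module.Finite R M]

omit [IsNoetherianRing R] [Module.Finite R M] in
lemma bIdeal_kill {d : ℕ} {b : R} (hb : b ∈ bIdeal R M d) {x : Fin d → R} (hx : IsSOP R M d x)
    (i : Fin d) (v : M) (hv : x i • v ∈ (Ideal.span (x '' {j | j < i}) • ⊤ : Submodule R M)) :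
    b • v ∈ (Ideal.span (x '' {j | j < i}) • ⊤ : Submodule R M) := by
  unfold bIdeal at hb
  simp only [Submodule.mem_iInf] at hb
  have := hb x hx i
  rw [Module.mem_annihilator] at this
  have h2 := this ⟨Submodule.Quotient.mk v, by
    rw [Submodule.mem_torsionBy_iff, ← Submodule.Quotient.mk_smul, Submodule.Quotient.mk_eq_zero]
    exact hv⟩
  have h3 : b • (Submodule.Quotient.mk v : M ⧸ (Ideal.span (x '' {j | j < i}) • ⊤ : Submodule R M)) = 0 :=
    congrArg Subtype.val h2
  rwa [← Submodule.Quotient.mk_smul, Submodule.Quotient.mk_eq_zero] at h3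

lemma sop_update {d : ℕ} {z : Fin d → R} (hz : IsSOP R M d z) (j : Fin d) (y : R) (n : ℕ)
    (hy : y ∈ maximalIdeal R) (hzy : z j - y ∈ Ideal.span (z '' {k | j < k})) :
    IsSOP R M d (Function.update z j (y ^ (n+1))) := by
  rw [isSOP_iff] at hz ⊢
  obtain ⟨h1, h2⟩ := hz
  refine ⟨fun i => ?_, ?_⟩
  · by_cases hij : i = j
    · subst hij; rw [Function.update_self]; exact Ideal.pow_mem_of_mem _ hy _ (by omega)
    · rw [Function.update_of_ne hij]; exact h1 i
  · refine h2.trans (Ideal.radical_le_radical_iff.2 (sup_le (le_sup_left.trans Ideal.le_radical) ?_))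
    rw [Ideal.span_le]
    have key : ∀ k, k ≠ j → z k ∈ Ideal.span (Set.range (Function.update z j (y ^ (n+1)))) := by
      intro k hk
      exact Ideal.subset_span ⟨k, Function.update_of_ne hk _ _⟩
    rintro _ ⟨k, rfl⟩
    by_cases hk : k = j
    · subst hk
      have e : z k = (z k - y) + y := by ring
      rw [e]
      refine add_mem ?_ ?_
      · refine Ideal.le_radical (Ideal.mem_sup_right ?_)
        refine (Ideal.span_le.2 ?_ : Ideal.span (z '' {l | k < l}) ≤ _) hzy
        rintro _ ⟨l, hl, rfl⟩
        exact key l (ne_of_gt hl)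
      · exact ⟨n+1, Ideal.mem_sup_right (Ideal.subset_span ⟨k, Function.update_self ..⟩)⟩
    · exact Ideal.le_radical (Ideal.mem_sup_right (key k hk))

omit [IsLocalRing R] [IsNoetherianRing R] in
lemma update_image_lt {d : ℕ} (z : Fin d → R) (j : Fin d) (y : R) :
    Function.update z j y '' {k | k < j} = z '' {k | k < j} := by
  apply Set.image_congr
  intro k hk
  exact Function.update_of_ne (ne_of_lt hk) _ _

omit [IsLocalRing R] [IsNoetherianRing R] [Module.Finite R M] in
lemma ann_quot (I : Ideal R) : I ≤ Module.annihilator R (M ⧸ (I • ⊤ : Submodule R M)) := by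
  intro r hr
  rw [Module.mem_annihilator]
  intro v
  obtain ⟨v, rfl⟩ := Submodule.mkQ_surjective _ v
  rw [← map_smul, Submodule.mkQ_apply, Submodule.Quotient.mk_eq_zero]
  exact Submodule.smul_mem_smul hr trivial

lemma b_kills {d : ℕ} {b : R} (hb : b ∈ bIdeal R M d) (i : ℕ) :
    ∀ (z : Fin d → R) (_ : IsSOP R M d z) (j : Fin d) (_ : i + j < d)
    (ξ : H (maximalIdeal R) i (M ⧸ (Ideal.span (z '' {k | k < j}) • ⊤ : Submodule R M))), b • ξ = 0 := by
  induction i with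
  | zero =>
    intro z hz j hj ξ
    obtain ⟨n, hn⟩ := H_torsion ξ
    apply H0ev_injective
    rw [map_smul, map_zero]
    have h1 : z j ^ (n+1) • H0ev (maximalIdeal R) _ ξ = 0 := by
      rw [← map_smul, hn _ (Ideal.pow_le_pow_right (Nat.le_succ n) (Ideal.pow_mem_pow (hz.1 j) _)), map_zero]
    obtain ⟨v, hv⟩ := Submodule.mkQ_surjective _ (H0ev (maximalIdeal R) _ ξ)
    rw [← hv, ← map_smul, Submodule.mkQ_apply, Submodule.Quotient.mk_eq_zero] at h1 ⊢
    have h2 := bIdeal_kill hb (sop_update hz j (z j) n (hz.1 j) (by simp)) j v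
    rw [update_image_lt, Function.update_self] at h2
    exact h2 h1
  | succ i ih =>
    intro z hz j hj
    set A : Submodule R M := Ideal.span (z '' {k | k < j}) • ⊤ with hA
    intro ξ
    have hz' := isSOP_iff.1 hz
    have hfin := associatedPrimes.finite R (M ⧸ A)
    have hprime : ∀ p : Ideal R, p.IsPrime → Module.annihilator R (M ⧸ A) ≤ p → z j ∈ p →
        Ideal.span (z '' {k | j < k}) ≤ p → p = maximalIdeal R := by
      intro p hp h1 h2 h3
      refine le_antisymm (IsLocalRing.le_maximalIdeal hp.ne_top) (hz'.2.trans ?_)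
      rw [hp.radical_le_iff]
      refine sup_le ((LinearMap.annihilator_le_of_surjective _ (Submodule.mkQ_surjective A)).trans h1) ?_
      rw [Ideal.span_le]
      rintro _ ⟨k, rfl⟩
      rcases lt_trichotomy k j with h | h | h
      · exact h1 (ann_quot _ (Ideal.subset_span ⟨k, h, rfl⟩))
      · subst h; exact h2
      · exact h3 (Ideal.subset_span ⟨k, h, rfl⟩)
    obtain ⟨w, hw, hw'⟩ := avoid (z j) (Ideal.span (z '' {k | j < k}))
      (hfin.toFinset.filter (· ≠ maximalIdeal R)) (by
        intro p hp
        simp only [Finset.mem_filter, Set.Finite.mem_toFinset] at hp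
        exact hp.1.isPrime) (by
        intro p hp h
        simp only [Finset.mem_filter, Set.Finite.mem_toFinset] at hp
        exact hp.2 (hprime p hp.1.isPrime (Submodule.annihilator_top (R := R) (M := M ⧸ A) ▸ hp.1.annihilator_le) h.1 h.2))
    have hwm : w ∈ maximalIdeal R := by
      refine (Ideal.span_le.2 ?_ : Ideal.span (z '' {k | j < k}) ≤ _) hw
      rintro _ ⟨k, -, rfl⟩
      exact hz.1 k
    have hym : z j + w ∈ maximalIdeal R := add_mem (hz.1 j) hwm
    obtain ⟨n, hn⟩ := H_torsion ξ
    have hyξ : (z j + w) ^ (n+1) • ξ = 0 :=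
      hn _ (Ideal.pow_le_pow_right (Nat.le_succ n) (Ideal.pow_mem_pow hym _))
    set y := (z j + w) ^ (n+1) with hy
    have hz2 := sop_update hz j (z j + w) n hym (by simpa using hw)
    rw [← hy] at hz2
    let j' : Fin d := ⟨j + 1, by omega⟩
    have hset : (Function.update z j y) '' {k | k < j'} = insert y (z '' {k | k < j}) := by
      have : {k : Fin d | k < j'} = insert j {k | k < j} := by
        ext k
        simp only [Set.mem_ofPred_eq, Set.mem_insert_iff, Fin.lt_def, Fin.ext_iff, j']
        omega
      rw [this, Set.image_insert_eq, update_image_lt, Function.update_self]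
    set B : Submodule R M := Ideal.span ((Function.update z j y) '' {k | k < j'}) • ⊤ with hB
    have hB2 : B = A ⊔ Ideal.span {y} • ⊤ := by
      rw [hB, hset, Ideal.span_insert, Submodule.sup_smul, sup_comm]
    have hAB : A ≤ B := hB2 ▸ le_sup_left
    refine lemL y b (Submodule.factor hAB) (Submodule.factor_surjective hAB) (factor_ker hAB y hB2) ?_ ?_ ξ hyξ
    · apply H_tors_zero
      have hrad : maximalIdeal R ≤ (Module.annihilator R (LinearMap.ker (LinearMap.lsmul R (M ⧸ A) y))).radical := by
        rw [← Ideal.sInf_minimalPrimes]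
        refine le_sInf fun p hp => ?_
        have hp1 := Module.associatedPrimes.minimalPrimes_annihilator_subset_associatedPrimes R _ hp
        have hp2 : p ∈ associatedPrimes R (M ⧸ A) :=
          associatedPrimes.subset_of_injective (Submodule.subtype_injective _) hp1
        by_contra hne
        have hpm : p ≠ maximalIdeal R := fun h => hne h.ge
        refine hw' p (by simp [hp2, hpm]) ?_
        have hyp : y ∈ p := by
          refine hp.1.2 ?_
          rw [Module.mem_annihilator]
          rintro ⟨v, hv⟩
          exact Subtype.ext hv
        exact hp.1.1.mem_of_pow_mem _ hyp
      obtain ⟨n, hn⟩ := le_rad_pow hrad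
      exact fun v => ⟨n, fun r hr => Module.mem_annihilator.1 (hn hr) v⟩
    · exact ih _ hz2 j' (by simp only [j']; omega)

end LC

namespace LC
open CategoryTheory Abelian

variable {R : Type u} [CommRing R]

lemma mem_mul_rep {I K : Ideal R} {a : R} (ha : a ∈ I * K) :
    ∃ (ι : Type) (_ : Fintype ι) (b c : ι → R), (∀ i, b i ∈ I) ∧ (∀ i, c i ∈ K) ∧ a = ∑ i, b i * c i := by
  refine Submodule.mul_induction_on ha ?_ ?_
  · intro m hm n hn
    exact ⟨Unit, inferInstance, fun _ => m, fun _ => n, fun _ => hm, fun _ => hn, by simp⟩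
  · rintro x y ⟨ι, _, b, c, hb, hc, rfl⟩ ⟨κ, _, b', c', hb', hc', rfl⟩
    refine ⟨ι ⊕ κ, inferInstance, Sum.elim b b', Sum.elim c c', ?_, ?_, by simp⟩
    · rintro (i | i); exacts [hb i, hb' i]
    · rintro (i | i); exacts [hc i, hc' i]

variable [IsLocalRing R] [IsNoetherianRing R]

lemma b_kills0 {N : Type u} [AddCommGroup N] [Module R N] [Module.Finite R N] {e : ℕ} {y : Fin (e+1) → R}
    (hy : IsSOP R N (e+1) y) {b : R} (hb : b ∈ bIdeal R N (e+1)) (η : H (maximalIdeal R) e N) : b • η = 0 := by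
  have h := b_kills hb e y hy 0 (by simp)
  have h0 : (Ideal.span (y '' {k | k < 0}) • ⊤ : Submodule R N) = ⊥ := by simp
  let E := Submodule.quotEquivOfEqBot _ h0
  have h1 : η = Hmap _ e E.toLinearMap (Hmap _ e E.symm.toLinearMap η) := by
    rw [Hmap_comp]
    have : E.toLinearMap ∘ₗ E.symm.toLinearMap = LinearMap.id := by ext; simp
    rw [this, Hmap_id]
  rw [h1, ← map_smul, h, map_zero]

lemma main_step {N N' : Type u} [AddCommGroup N] [Module R N] [Module.Finite R N]
    [AddCommGroup N'] [Module R N'] {e : ℕ} {y : Fin (e+1) → R}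
    (hy : IsSOP R N (e+1) y) (ha : y 0 ∈ (bIdeal R N (e+1)) ^ 3)
    (π : N →ₗ[R] N') (hπ : Function.Surjective π)
    (hk : LinearMap.ker π = LinearMap.range (LinearMap.lsmul R N (y 0))) :
    ∃ φ : H (maximalIdeal R) e N' →ₗ[R] H (maximalIdeal R) (e+1) N,
      ∀ s, (∀ r ∈ maximalIdeal R, r • s = 0) →
        ∃ u, (∀ r ∈ maximalIdeal R, r • u = 0) ∧ φ u = s := by
  set J := maximalIdeal R with hJ
  set a := y 0 with haa
  set U := LinearMap.ker (LinearMap.lsmul R N a) with hU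
  have haJ : a ∈ J := hy.1 0
  have hbU : ∀ c ∈ bIdeal R N (e+1), ∀ v ∈ U, c • v = 0 := by
    intro c hc v hv
    have h := bIdeal_kill hc hy 0 v (by
      have : y 0 • v = 0 := hv
      rw [this]; exact zero_mem _)
    simpa using h
  obtain ⟨ι, _, b, c, hb, hcJ, hcU, hbc⟩ : ∃ (ι : Type) (_ : Fintype ι) (b c : ι → R),
      (∀ i, b i ∈ bIdeal R N (e+1)) ∧ (∀ i, c i ∈ J) ∧ (∀ i, ∀ v ∈ U, c i • v = 0) ∧
      a = ∑ i, b i * c i := by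
    by_cases htop : bIdeal R N (e+1) = ⊤
    · refine ⟨Unit, inferInstance, fun _ => 1, fun _ => a, ?_, fun _ => haJ, fun _ v hv => hv, by simp⟩
      rw [htop]; simp
    · have ha2 : a ∈ bIdeal R N (e+1) * bIdeal R N (e+1) := by
        rw [← pow_two]; exact Ideal.pow_le_pow_right (by norm_num) ha
      obtain ⟨ι, i1, b, c, hb, hc, h⟩ := mem_mul_rep ha2
      exact ⟨ι, i1, b, c, hb, fun i => IsLocalRing.le_maximalIdeal htop (hc i), fun i => hbU _ (hc i), h⟩
  classical
  have hvan : ∀ i, e < i → ∀ ξ : H J i U, ξ = 0 := by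
    intro i hi
    refine H_vanish J (List.ofFn (fun i : Fin e => y i.succ)) ?_ i U ?_ (by simpa using hi)
    · intro r hr
      obtain ⟨k, rfl⟩ := (List.mem_ofFn' _ _).1 hr
      exact hy.1 _
    · refine (isSOP_iff.1 hy).2.trans (Ideal.radical_mono (sup_le ?_ ?_))
      · exact (LinearMap.annihilator_le_of_injective _ (Submodule.subtype_injective U)).trans le_sup_left
      · rw [Ideal.span_le]
        rintro _ ⟨k, rfl⟩
        refine Fin.cases ?_ ?_ k
        · refine Ideal.mem_sup_left ?_
          rw [Module.mem_annihilator]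
          rintro ⟨v, hv⟩
          exact Subtype.ext hv
        · intro k
          refine Ideal.mem_sup_right (Ideal.subset_span ?_)
          exact (List.mem_ofFn' _ _).2 ⟨k, rfl⟩
  let V := N ⧸ U
  let q0 : N →ₗ[R] V := U.mkQ
  have hq0 : Function.Surjective q0 := Submodule.mkQ_surjective _
  have hex0 : Function.Exact U.subtype q0 := LinearMap.exact_subtype_mkQ U
  have hinj0 : Function.Injective U.subtype := Submodule.subtype_injective _
  let E : H J (e+1) N ≃ₗ[R] H J (e+1) V := LinearEquiv.ofBijective (Hmap J (e+1) q0) (by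
    constructor
    · rw [injective_iff_map_eq_zero]
      intro ξ hξ
      obtain ⟨η, rfl⟩ := H_exact₂ hinj0 hex0 hq0 ξ hξ
      rw [hvan _ (by omega) η, map_zero]
    · intro ξ
      exact H_exact₃ hinj0 hex0 hq0 ξ (hvan _ (by omega) _))
  -- multiplication by `a` on `V`
  let ab : V →ₗ[R] N := U.liftQ (LinearMap.lsmul R N a) le_rfl
  have hab : Function.Injective ab := by
    rw [← LinearMap.ker_eq_bot]; exact Submodule.ker_liftQ_eq_bot _ _ _ le_rfl
  have hexa : Function.Exact ab π := by
    rw [LinearMap.exact_iff, hk, Submodule.range_liftQ]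
  let pc : N →ₗ[R] (ι → N) := LinearMap.pi (fun i => LinearMap.lsmul R N (c i))
  let cb : V →ₗ[R] (ι → N) := U.liftQ pc (by
    intro v hv
    ext i
    exact hcU i v hv)
  have hcb : Function.Injective cb := by
    rw [← LinearMap.ker_eq_bot]
    refine Submodule.ker_liftQ_eq_bot _ _ _ ?_
    intro v hv
    have hv' : ∀ i, c i • v = 0 := fun i => congrFun hv i
    change a • v = 0
    rw [hbc, Finset.sum_smul]
    exact Finset.sum_eq_zero fun i _ => by rw [mul_smul, hv', smul_zero]
  let q := (LinearMap.range cb).mkQ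
  have hq : Function.Surjective q := Submodule.mkQ_surjective _
  have hexc : Function.Exact cb q := LinearMap.exact_map_mkQ_range cb
  let B : (ι → N) →ₗ[R] N := ∑ i, b i • LinearMap.proj i
  have hBc : B ∘ₗ cb = ab := by
    refine LinearMap.ext fun v => ?_
    obtain ⟨v, rfl⟩ := hq0 v
    change B (pc v) = a • v
    simp only [B, pc, LinearMap.sum_apply, LinearMap.smul_apply, LinearMap.proj_apply, LinearMap.pi_apply,
      LinearMap.lsmul_apply]
    rw [hbc, Finset.sum_smul]
    simp only [mul_smul]
  let Bb : ((ι → N) ⧸ LinearMap.range cb) →ₗ[R] N' := (LinearMap.range cb).liftQ (π ∘ₗ B) (by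
    rintro _ ⟨v, rfl⟩
    change π ((B ∘ₗ cb) v) = 0
    rw [hBc]
    exact hexa.apply_apply_eq_zero v)
  have hBb : Bb ∘ₗ q = π ∘ₗ B := by ext; rfl
  refine ⟨E.symm.toLinearMap ∘ₗ Hδ J e hab hexa hπ, fun s hs => ?_⟩
  have hcs : Hmap J (e+1) cb (Hmap J (e+1) q0 s) = 0 := by
    rw [Hmap_comp]
    have e1 : cb ∘ₗ q0 = ∑ i, c i • LinearMap.single R (fun _ : ι => N) i := by
      refine LinearMap.ext fun v => ?_
      change pc v = _
      ext i
      simp [pc, LinearMap.sum_apply, Finset.sum_apply, Pi.single_apply]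
    rw [e1, Hmap_sum]
    refine Finset.sum_eq_zero fun i _ => ?_
    rw [Hmap_smul, ← map_smul, hs _ (hcJ i), map_zero]
  obtain ⟨t, ht⟩ := H_exact₁ hcb hexc hq _ hcs
  refine ⟨Hmap J e Bb t, fun r hr => ?_, ?_⟩
  · have h1 : Hδ J e hcb hexc hq (r • t) = 0 := by
      rw [map_smul, ht, ← map_smul, hs r hr, map_zero]
    obtain ⟨η, hη⟩ := H_exact₃ hcb hexc hq _ h1
    rw [← map_smul, ← hη, Hmap_comp, hBb, ← Hmap_comp]
    have : Hmap J e B η = 0 := by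
      rw [Hmap_sum]
      refine Finset.sum_eq_zero fun i _ => ?_
      rw [Hmap_smul, b_kills0 hy (hb i)]
    rw [this, map_zero]
  · change E.symm (Hδ J e hab hexa hπ (Hmap J e Bb t)) = s
    rw [Hδ_nat hcb hexc hq hab hexa hπ B Bb hBc hBb, ht]
    exact E.symm_apply_apply s

end LC

namespace LC
open CategoryTheory Abelian

variable {R : Type u} [CommRing R] [IsLocalRing R] [IsNoetherianRing R]

lemma chain {M : Type u} [AddCommGroup M] [Module R M] [Module.Finite R M] {d : ℕ} {x : Fin d → R}
    (hx : IsCSOP R M d x) (j : ℕ) : j ≤ d →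
    ∃ φ : H (maximalIdeal R) 0 (M ⧸ (Ideal.span (x '' {k | 0 ≤ k.val}) • ⊤ : Submodule R M)) →ₗ[R]
        H (maximalIdeal R) j (M ⧸ (Ideal.span (x '' {k | j ≤ k.val}) • ⊤ : Submodule R M)),
      ∀ s, (∀ r ∈ maximalIdeal R, r • s = 0) →
        ∃ u, (∀ r ∈ maximalIdeal R, r • u = 0) ∧ φ u = s := by
  induction j with
  | zero => exact fun _ => ⟨LinearMap.id, fun s hs => ⟨s, hs, rfl⟩⟩
  | succ j ih =>
    intro hj
    obtain ⟨φ, hφ⟩ := ih (by omega)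
    let y : Fin (j+1) → R := fun k => x ⟨j - k, by omega⟩
    let A : Submodule R M := Ideal.span (x '' {k | j + 1 ≤ k.val}) • ⊤
    let A' : Submodule R M := Ideal.span (x '' {k | j ≤ k.val}) • ⊤
    have hy0 : y 0 = x ⟨j, by omega⟩ := rfl
    have hy : IsSOP R (M ⧸ A) (j+1) y := by
      rw [isSOP_iff]
      refine ⟨fun k => hx.1.1 _, (isSOP_iff.1 hx.1).2.trans (Ideal.radical_mono (sup_le ?_ ?_))⟩
      · exact (LinearMap.annihilator_le_of_surjective _ (Submodule.mkQ_surjective A)).trans le_sup_left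
      · rw [Ideal.span_le]
        rintro _ ⟨k, rfl⟩
        by_cases hk : j + 1 ≤ k.val
        · exact Ideal.mem_sup_left (ann_quot _ (Ideal.subset_span ⟨k, hk, rfl⟩))
        · refine Ideal.mem_sup_right (Ideal.subset_span ⟨⟨j - k, by omega⟩, ?_⟩)
          simp only [y]
          congr 1
          ext
          simp only
          omega
    have hset : x '' {k | j ≤ k.val} = insert (y 0) (x '' {k | j + 1 ≤ k.val}) := by
      rw [hy0, ← Set.image_insert_eq]
      congr 1
      ext k
      simp only [Set.mem_ofPred_eq, Set.mem_insert_iff, Fin.ext_iff]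
      omega
    have hA' : A' = A ⊔ Ideal.span {y 0} • ⊤ := by
      simp only [A', A]
      rw [hset, Ideal.span_insert, Submodule.sup_smul, sup_comm]
    have hAA : A ≤ A' := hA' ▸ le_sup_left
    obtain ⟨ψ, hψ⟩ := main_step hy (hx.2 ⟨j, by omega⟩) (Submodule.factor hAA)
      (Submodule.factor_surjective hAA) (factor_ker hAA _ hA')
    refine ⟨ψ ∘ₗ φ, fun s hs => ?_⟩
    obtain ⟨u, hu, rfl⟩ := hψ s hs
    obtain ⟨v, hv, rfl⟩ := hφ u hu
    exact ⟨v, hv, rfl⟩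

lemma chain_final {M : Type u} [AddCommGroup M] [Module R M] [Module.Finite R M] {d : ℕ} {x : Fin d → R}
    (hx : IsCSOP R M d x) :
    ∃ φ : H (maximalIdeal R) 0 (M ⧸ (Ideal.span (Set.range x) • ⊤ : Submodule R M)) →ₗ[R]
        H (maximalIdeal R) d M,
      ∀ s, (∀ r ∈ maximalIdeal R, r • s = 0) →
        ∃ u, (∀ r ∈ maximalIdeal R, r • u = 0) ∧ φ u = s := by
  have h := chain hx d le_rfl
  have h0 : x '' {k | 0 ≤ k.val} = Set.range x := by
    rw [← Set.image_univ]; congr 1; ext; simp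
  rw [h0] at h
  obtain ⟨φ, hφ⟩ := h
  have h1 : (Ideal.span (x '' {k | d ≤ k.val}) • ⊤ : Submodule R M) = ⊥ := by
    have : {k : Fin d | d ≤ k.val} = ∅ := by ext k; simp
    rw [this]; simp
  let E := Submodule.quotEquivOfEqBot _ h1
  refine ⟨Hmap _ d E.toLinearMap ∘ₗ φ, fun s hs => ?_⟩
  obtain ⟨u, hu, h⟩ := hφ (Hmap _ d E.symm.toLinearMap s) (fun r hr => by rw [← map_smul, hs r hr, map_zero])
  refine ⟨u, hu, ?_⟩
  rw [LinearMap.comp_apply, h, Hmap_comp]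
  have : E.toLinearMap ∘ₗ E.symm.toLinearMap = LinearMap.id := by ext; simp
  rw [this, Hmap_id]

/-- restriction to socles. -/
def socMap (I : Ideal R) {N N' : Type u} [AddCommGroup N] [Module R N] [AddCommGroup N'] [Module R N']
    (f : N →ₗ[R] N') : Submodule.torsionBySet R N (I : Set R) →ₗ[R] Submodule.torsionBySet R N' (I : Set R) :=
  f.restrict (by
    intro v hv
    rw [Submodule.mem_torsionBySet_iff] at hv ⊢
    intro r
    rw [← map_smul, hv r, map_zero])

lemma soc_surj {M : Type u} [AddCommGroup M] [Module R M] [Module.Finite R M] {d : ℕ} {x : Fin d → R}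
    (hx : IsCSOP R M d x) :
    ∃ F : Submodule.torsionBySet R
          (M ⧸ (Ideal.span (Set.range x) • ⊤ : Submodule R M)) (maximalIdeal R : Set R) →ₗ[R]
        Submodule.torsionBySet R (H (maximalIdeal R) d M) (maximalIdeal R : Set R),
      Function.Surjective F := by
  obtain ⟨φ, hφ⟩ := chain_final hx
  let E := LinearEquiv.ofBijective (socMap (maximalIdeal R) (H0ev (maximalIdeal R)
      (M ⧸ (Ideal.span (Set.range x) • ⊤ : Submodule R M)))) (by
    constructor
    · intro u v huv
      exact Subtype.ext (H0ev_injective (congrArg Subtype.val huv))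
    · rintro ⟨v, hv⟩
      rw [Submodule.mem_torsionBySet_iff] at hv
      obtain ⟨ξ, hξ⟩ := H0ev_surj (J := maximalIdeal R) v 1 (fun r hr => hv ⟨r, by simpa using hr⟩)
      refine ⟨⟨ξ, ?_⟩, Subtype.ext hξ⟩
      rw [Submodule.mem_torsionBySet_iff]
      intro r
      apply H0ev_injective
      rw [map_smul, hξ, hv r, map_zero])
  refine ⟨socMap _ φ ∘ₗ E.symm.toLinearMap, ?_⟩
  rintro ⟨s, hs⟩
  rw [Submodule.mem_torsionBySet_iff] at hs
  obtain ⟨u, hu, hus⟩ := hφ s (fun r hr => hs ⟨r, hr⟩)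
  have hu' : u ∈ Submodule.torsionBySet R _ (maximalIdeal R : Set R) := by
    rw [Submodule.mem_torsionBySet_iff]
    exact fun r => hu r r.2
  refine ⟨E ⟨u, hu'⟩, Subtype.ext ?_⟩
  change φ (E.symm (E ⟨u, hu'⟩)).val = s
  rw [E.symm_apply_apply]
  exact hus
end LC

namespace LC
open CategoryTheory Abelian Opposite

section cmp
variable {R : Type u} [CommRing R]

/-- contravariant Hom, as a covariant functor to the opposite category. -/
noncomputable abbrev FY (Y : ModuleCat.{u} R) : ModuleCat.{u} R ⥤ (ModuleCat.{u} R)ᵒᵖ :=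
  ((linearYoneda R (ModuleCat.{u} R)).obj Y).rightOp

/-- The Hom complex. -/
noncomputable abbrev LY (Y : ModuleCat.{u} R) {X : ModuleCat.{u} R} (P : ProjectiveResolution X) :
    ChainComplex (ModuleCat.{u} R)ᵒᵖ ℕ :=
  ((FY Y).mapHomologicalComplex _).obj P.complex

variable (Y : ModuleCat.{u} R) {X : ModuleCat.{u} R} (P : ProjectiveResolution X) (n : ℕ)

/-- cocycles. -/
noncomputable abbrev ZY : ModuleCat.{u} R := ((LY Y P).opcycles n).unop

/-- inclusion of cocycles. -/
noncomputable def iZ : ZY Y P n →ₗ[R] (P.complex.X n ⟶ Y) :=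
  ((LY Y P).pOpcycles n).unop.hom

lemma iZ_inj : Function.Injective (iZ Y P n) := by
  have : Mono ((LY Y P).pOpcycles n).unop := inferInstance
  exact (ModuleCat.mono_iff_injective _).1 this

lemma d_iZ (z) : P.complex.d (n+1) n ≫ iZ Y P n z = 0 := by
  have h : (LY Y P).d (n+1) n ≫ (LY Y P).pOpcycles n = 0 := (LY Y P).d_pOpcycles _ _
  have h2 := congrArg Quiver.Hom.unop h
  have h3 := congrArg (fun f => f.hom z) h2
  exact h3

lemma iZ_surj (f : P.complex.X n ⟶ Y) (hf : P.complex.d (n+1) n ≫ f = 0) : ∃ z, iZ Y P n z = f := by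
  let g : ModuleCat.of R R ⟶ ((LY Y P).X n).unop :=
    ModuleCat.ofHom (LinearMap.toSpanSingleton R (P.complex.X n ⟶ Y) f)
  have hg : (LY Y P).d (n+1) n ≫ g.op = 0 := by
    apply Quiver.Hom.unop_inj
    refine ModuleCat.hom_ext (LinearMap.ext fun r => ?_)
    change P.complex.d (n+1) n ≫ (r • f) = 0
    rw [Linear.comp_smul, hf, smul_zero]
  let k := (LY Y P).descOpcycles g.op (n+1) (by simp) hg
  have hk : (LY Y P).pOpcycles n ≫ k = g.op := (LY Y P).p_descOpcycles _ _ _ _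
  refine ⟨k.unop.hom (1 : R), ?_⟩
  have h2 := congrArg (fun f => f.unop.hom (1 : R)) hk
  refine Eq.trans h2 ?_
  change (1 : R) • f = f
  rw [one_smul]

/-- to new Ext. -/
noncomputable def toNew : ZY Y P n →ₗ[R] Ext X Y n where
  toFun z := P.extMk (iZ Y P n z) (n+1) rfl (d_iZ Y P n z)
  map_add' a b := by
    rw [ProjectiveResolution.add_extMk]; congr 1; exact map_add _ _ _
  map_smul' r a := by
    have h := P.extMk_comp_mk₀ (iZ Y P n a) (n+1) rfl (d_iZ Y P n a) (r • 𝟙 Y)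
    rw [Ext.mk₀_smul, Ext.comp_smul, Ext.comp_mk₀_id] at h
    refine Eq.trans ?_ h.symm
    congr 1
    rw [map_smul, Linear.comp_smul, Category.comp_id]

lemma toNew_surj : Function.Surjective (toNew Y P n) := by
  intro ξ
  obtain ⟨f, hf, rfl⟩ := P.extMk_surjective ξ (n+1) rfl
  obtain ⟨z, rfl⟩ := iZ_surj Y P n f hf
  exact ⟨z, rfl⟩

/-- computation of the derived functor. -/
noncomputable def isoD : ((FY Y).leftDerived n).obj X ≅ (LY Y P).homology n :=
  P.isoLeftDerivedObj (FY Y) n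

/-- to old Ext. -/
noncomputable def toOld : ZY Y P n →ₗ[R] ((_root_.Ext R (ModuleCat.{u} R) n).obj (op X)).obj Y :=
  (((isoD Y P n).hom ≫ (LY Y P).homologyι n).unop).hom

lemma toOld_surj : Function.Surjective (toOld Y P n) := by
  have : Mono ((LY Y P).homologyι n) :=
    inferInstanceAs (Mono (ShortComplex.homologyι _))
  have : Mono ((isoD Y P n).hom ≫ (LY Y P).homologyι n) := mono_comp _ _
  have : Epi (((isoD Y P n).hom ≫ (LY Y P).homologyι n).unop) :=
    unop_epi_of_mono _
  exact (ModuleCat.epi_iff_surjective _).1 this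

lemma ker_eq (p : ℕ) (z : ZY Y P (p+1)) : toOld Y P (p+1) z = 0 ↔ toNew Y P (p+1) z = 0 := by
  change _ ↔ P.extMk (iZ Y P (p+1) z) (p+1+1) rfl (d_iZ Y P (p+1) z) = 0
  rw [ProjectiveResolution.extMk_eq_zero_iff _ _ _ _ _ p rfl]
  let φ : ((LY Y P).X p).unop ⟶ ZY Y P (p+1) := ((LY Y P).fromOpcycles (p+1) p).unop
  have hφ : ∀ g : P.complex.X p ⟶ Y, iZ Y P (p+1) (φ.hom g) = P.complex.d (p+1) p ≫ g := by
    intro g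
    have h := congrArg (fun f => f.unop.hom g) ((LY Y P).p_fromOpcycles (p+1) p)
    exact h
  have hex : toOld Y P (p+1) z = 0 ↔ ∃ g, φ.hom g = z := by
    let S : ShortComplex (ModuleCat.{u} R)ᵒᵖ := ShortComplex.mk ((LY Y P).homologyι (p+1))
      ((LY Y P).fromOpcycles (p+1) p) ((LY Y P).homologyι_comp_fromOpcycles _ _)
    have hS : S.Exact := S.exact_of_f_is_kernel ((LY Y P).homologyIsKernel (p+1) p (by simp))
    have hS2 := (ShortComplex.moduleCat_exact_iff S.unop).1 hS.unop
    have hi : Function.Injective (isoD Y P (p+1)).hom.unop.hom := by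
      have : Mono (isoD Y P (p+1)).hom.unop := unop_mono_of_epi _
      exact (ModuleCat.mono_iff_injective _).1 this
    constructor
    · intro h
      exact hS2 z (hi (h.trans (map_zero _).symm))
    · rintro ⟨g, rfl⟩
      have hz := congrArg (fun f => f.unop.hom g) ((LY Y P).homologyι_comp_fromOpcycles (p+1) p)
      have hz' : ((LY Y P).homologyι (p+1)).unop.hom (φ.hom g) = 0 := hz
      change (isoD Y P (p+1)).hom.unop.hom
        (((LY Y P).homologyι (p+1)).unop.hom (φ.hom g)) = 0
      rw [hz', map_zero]
  rw [hex]
  constructor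
  · rintro ⟨g, rfl⟩; exact ⟨g, (hφ g).symm⟩
  · rintro ⟨g, hg⟩; exact ⟨g, iZ_inj _ _ _ ((hφ g).trans hg)⟩

/-- comparison of the two Ext modules. -/
noncomputable def cmp (X Y : ModuleCat.{u} R) (p : ℕ) :
    Ext X Y (p+1) ≃ₗ[R] ((_root_.Ext R (ModuleCat.{u} R) (p+1)).obj (op X)).obj Y :=
  ((toNew Y (projectiveResolution X) (p+1)).quotKerEquivOfSurjective (toNew_surj _ _ _)).symm ≪≫ₗ
  Submodule.quotEquivOfEq _ _ (by
    ext z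
    exact (ker_eq Y (projectiveResolution X) p z).symm) ≪≫ₗ
  ((toOld Y (projectiveResolution X) (p+1)).quotKerEquivOfSurjective (toOld_surj _ _ _))

lemma cmp_toNew (X Y : ModuleCat.{u} R) (p : ℕ) (z) :
    cmp X Y p (toNew Y (projectiveResolution X) (p+1) z) =
      toOld Y (projectiveResolution X) (p+1) z := by
  have h : ((toNew Y (projectiveResolution X) (p+1)).quotKerEquivOfSurjective
    (toNew_surj _ _ _)).symm (toNew Y (projectiveResolution X) (p+1) z) =
      Submodule.Quotient.mk z := by
    rw [LinearEquiv.symm_apply_eq]; rfl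
  rw [cmp, LinearEquiv.trans_apply, LinearEquiv.trans_apply, h]
  rfl

lemma cmp_nat {X X' : ModuleCat.{u} R} (Y : ModuleCat.{u} R) (p : ℕ) (f : X' ⟶ X)
    (ξ : Ext X Y (p+1)) : cmp X' Y p ((Ext.mk₀ f).comp ξ (zero_add _)) =
      ((_root_.Ext R (ModuleCat.{u} R) (p+1)).map f.op).app Y (cmp X Y p ξ) := by
  obtain ⟨z, rfl⟩ := toNew_surj Y (projectiveResolution X) (p+1) ξ
  let P := projectiveResolution X
  let P' := projectiveResolution X'
  let φ := ProjectiveResolution.lift f P' P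
  have hφ : φ.f 0 ≫ P.π.f 0 = P'.π.f 0 ≫ ((ChainComplex.single₀ _).map f).f 0 := by
    have := congrArg (fun g => g.f 0) (ProjectiveResolution.lift_commutes f P' P)
    exact this
  let Φ : ProjectiveResolution.Hom P' P f := ⟨φ, hφ⟩
  let ψ : LY Y P' ⟶ LY Y P := ((FY Y).mapHomologicalComplex _).map φ
  let w : ZY Y P' (p+1) := (HomologicalComplex.opcyclesMap ψ (p+1)).unop.hom z
  have hw : iZ Y P' (p+1) w = φ.f (p+1) ≫ iZ Y P (p+1) z := by
    have := congrArg (fun g => g.unop.hom z) (HomologicalComplex.p_opcyclesMap ψ (p+1))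
    exact this
  have h1 : (Ext.mk₀ f).comp (toNew Y P (p+1) z) (zero_add _) = toNew Y P' (p+1) w := by
    refine (ProjectiveResolution.mk₀_comp_extMk (iZ Y P (p+1) z) (p+1+1) rfl
      (d_iZ Y P (p+1) z) Φ).trans ?_
    change _ = P'.extMk (iZ Y P' (p+1) w) (p+1+1) rfl (d_iZ Y P' (p+1) w)
    congr 1
    exact hw.symm
  rw [h1, cmp_toNew, cmp_toNew]
  have h2 : ((FY Y).leftDerived (p+1)).map f ≫ (isoD Y P (p+1)).hom = (isoD Y P' (p+1)).hom ≫
      HomologicalComplex.homologyMap ψ (p+1) :=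
    ProjectiveResolution.isoLeftDerivedObj_hom_naturality f P' P φ (by
      rw [hφ]; rfl) (FY Y) (p+1)
  have h3 := HomologicalComplex.homologyι_naturality ψ (p+1)
  have h4 : (((FY Y).leftDerived (p+1)).map f) ≫ ((isoD Y P (p+1)).hom ≫
      (LY Y P).homologyι (p+1)) =
      ((isoD Y P' (p+1)).hom ≫ (LY Y P').homologyι (p+1)) ≫
        HomologicalComplex.opcyclesMap ψ (p+1) := by
    rw [← Category.assoc, h2, Category.assoc, Category.assoc, ← h3]
  exact (congrArg (fun g => g.unop.hom z) h4).symm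

/-- the transition functor. -/
noncomputable def legs (J : Ideal R) (p : ℕ) (N : Type u) [AddCommGroup N] [Module R N] (n : ℕ) :
    ((_root_.Ext R (ModuleCat.{u} R) (p+1)).obj (op (Q J n))).obj (ModuleCat.of R N) ⟶
      (localCohomology J (p+1)).obj (ModuleCat.of R N) :=
  haveI := localCohomology.hasColimitDiagram (localCohomology.idealPowersDiagram J) (p+1)
  (Limits.colimit.ι (localCohomology.diagram (localCohomology.idealPowersDiagram J) (p+1))
    (op (op n))).app (ModuleCat.of R N)

lemma legs_tr (J : Ideal R) (p : ℕ) (N : Type u) [AddCommGroup N] [Module R N] (n m : ℕ)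
    (h : n ≤ m) : ((_root_.Ext R (ModuleCat.{u} R) (p+1)).map (tr J h).op).app (ModuleCat.of R N) ≫
      legs J p N m = legs J p N n := by
  have := localCohomology.hasColimitDiagram (localCohomology.idealPowersDiagram J) (p+1)
  have := Limits.colimit.w (localCohomology.diagram (localCohomology.idealPowersDiagram J) (p+1))
    (homOfLE h).op.op
  exact congrArg (fun g => g.app (ModuleCat.of R N)) this

lemma legs_rep (J : Ideal R) (p : ℕ) (N : Type u) [AddCommGroup N] [Module R N]
    (ξ : (localCohomology J (p+1)).obj (ModuleCat.of R N)) : ∃ n x, (legs J p N n).hom x = ξ := by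
  have := localCohomology.hasColimitDiagram (localCohomology.idealPowersDiagram J) (p+1)
  let D := localCohomology.diagram (localCohomology.idealPowersDiagram J) (p+1)
  have : IsFiltered (ℕᵒᵖᵒᵖ) := inferInstance
  have : Limits.PreservesFilteredColimitsOfSize.{0,0} (forget (ModuleCat.{u} R)) :=
    Limits.preservesFilteredColimitsOfSize_shrink.{0, u, 0, u} _
  have hc := Limits.isColimitOfPreserves ((evaluation _ _).obj (ModuleCat.of R N))
    (Limits.colimit.isColimit D)
  obtain ⟨j, y, hy⟩ := Limits.Concrete.isColimit_exists_rep _ hc ξ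
  exact ⟨j.unop.unop, y, hy⟩

lemma legs_zero (J : Ideal R) (p : ℕ) (N : Type u) [AddCommGroup N] [Module R N] (n : ℕ) (x)
    (hx : (legs J p N n).hom x = 0) : ∃ m, ∃ h : n ≤ m,
      ((_root_.Ext R (ModuleCat.{u} R) (p+1)).map (tr J h).op).app (ModuleCat.of R N) x = 0 := by
  have := localCohomology.hasColimitDiagram (localCohomology.idealPowersDiagram J) (p+1)
  let D := localCohomology.diagram (localCohomology.idealPowersDiagram J) (p+1)
  have : IsFiltered (ℕᵒᵖᵒᵖ) := inferInstance
  have : Limits.PreservesFilteredColimitsOfSize.{0,0} (forget (ModuleCat.{u} R)) :=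
    Limits.preservesFilteredColimitsOfSize_shrink.{0, u, 0, u} _
  have hc := Limits.isColimitOfPreserves ((evaluation _ _).obj (ModuleCat.of R N))
    (Limits.colimit.isColimit D)
  obtain ⟨j, f, g, hy⟩ := Limits.Concrete.isColimit_exists_of_rep_eq
    (D ⋙ (evaluation _ _).obj (ModuleCat.of R N)) hc (i := op (op n)) (j := op (op n))
      x 0 (hx.trans (map_zero _).symm)
  rw [map_zero] at hy
  exact ⟨j.unop.unop, leOfHom f.unop.unop, hy⟩

/-- comparison map. -/
noncomputable def cmpH (J : Ideal R) (p : ℕ) (N : Type u) [AddCommGroup N] [Module R N] :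
    H J (p+1) N →ₗ[R] (localCohomology J (p+1)).obj (ModuleCat.of R N) :=
  Hlift (fun n => (legs J p N n).hom ∘ₗ (cmp (Q J n) (ModuleCat.of R N) p).toLinearMap) (by
    intro n m h x
    simp only [LinearMap.comp_apply, LinearEquiv.coe_coe]
    rw [cmp_nat]
    exact congrArg (fun g => g.hom (cmp (Q J n) (ModuleCat.of R N) p x)) (legs_tr J p N n m h))

lemma cmpH_surj (J : Ideal R) (p : ℕ) (N : Type u) [AddCommGroup N] [Module R N] :
    Function.Surjective (cmpH J p N) := by
  intro ξ
  obtain ⟨n, x, rfl⟩ := legs_rep J p N ξ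
  refine ⟨Hof _ _ _ n ((cmp _ _ p).symm x), ?_⟩
  rw [cmpH, Hlift_of]
  simp

lemma cmpH_inj (J : Ideal R) (p : ℕ) (N : Type u) [AddCommGroup N] [Module R N] :
    Function.Injective (cmpH J p N) := by
  rw [injective_iff_map_eq_zero]
  intro ξ hξ
  obtain ⟨n, x, rfl⟩ := H_rep ξ
  rw [cmpH, Hlift_of] at hξ
  obtain ⟨m, h, h0⟩ := legs_zero J p N n _ hξ
  have h1 : cmp (Q J m) (ModuleCat.of R N) p ((Ext.mk₀ (tr J h)).comp x (zero_add _)) = 0 := by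
    rw [cmp_nat]; exact h0
  rw [LinearEquiv.map_eq_zero_iff] at h1
  rw [← Hof_tr h, h1, map_zero]

end cmp
end LC

/-- For a C-system of parameters `x` of `M`, there is a surjective `k`-linear
map `Soc(M/(x)M) ↠ Soc(H^d_m(M))`; in particular `dim_k Soc(H^d_m(M)) ≤ ir_M((x))`. -/
theorem stmt5 (R : Type u) [CommRing R] [IsLocalRing R] [IsNoetherianRing R]
    (hCM : IsQuotientOfCMLocalRing R)
    (M : Type u) [AddCommGroup M] [Module R M] [Module.Finite R M]
    (d : ℕ) (hd : 0 < d) (hdim : mdim R M = d)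
    (x : Fin d → R) (hx : IsCSOP R M d x) :
    (∃ f : Submodule.torsionBySet R
          (M ⧸ (Ideal.span (Set.range x) • ⊤ : Submodule R M)) (maximalIdeal R : Set R)
        →ₗ[R ⧸ maximalIdeal R]
        Submodule.torsionBySet R
          ((localCohomology (maximalIdeal R) d).obj (ModuleCat.of R M)) (maximalIdeal R : Set R),
      Function.Surjective f) ∧
    socH R M d ≤ ir R M (Ideal.span (Set.range x)) := by
  obtain ⟨p, rfl⟩ : ∃ p, d = p + 1 := ⟨d - 1, by omega⟩
  obtain ⟨F, hF⟩ := LC.soc_surj hx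
  obtain ⟨G, hG⟩ : ∃ G : Submodule.torsionBySet R
      (M ⧸ (Ideal.span (Set.range x) • ⊤ : Submodule R M)) (maximalIdeal R : Set R) →ₗ[R]
      Submodule.torsionBySet R ((localCohomology (maximalIdeal R) (p+1)).obj (ModuleCat.of R M))
        (maximalIdeal R : Set R), Function.Surjective G := by
    refine ⟨(LC.socMap (maximalIdeal R) (LC.cmpH (maximalIdeal R) p M)) ∘ₗ F, ?_⟩
    rw [LinearMap.coe_comp]
    refine Function.Surjective.comp ?_ hF
    rintro ⟨y, hy⟩
    obtain ⟨ξ, rfl⟩ := LC.cmpH_surj (maximalIdeal R) p M y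
    refine ⟨⟨ξ, ?_⟩, rfl⟩
    rw [Submodule.mem_torsionBySet_iff] at hy ⊢
    intro a
    apply LC.cmpH_inj (maximalIdeal R) p M
    rw [map_smul, map_zero]
    exact hy a
  let f : Submodule.torsionBySet R
      (M ⧸ (Ideal.span (Set.range x) • ⊤ : Submodule R M)) (maximalIdeal R : Set R)
      →ₗ[R ⧸ maximalIdeal R]
      Submodule.torsionBySet R ((localCohomology (maximalIdeal R) (p+1)).obj (ModuleCat.of R M))
        (maximalIdeal R : Set R) :=
    { toFun := G
      map_add' := map_add G
      map_smul' := by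
        intro c y
        obtain ⟨r, rfl⟩ := Ideal.Quotient.mk_surjective c
        exact map_smul G r y }
  have hf : Function.Surjective f := hG
  refine ⟨⟨f, hf⟩, ?_⟩
  have hfin : Module.Finite R (Submodule.torsionBySet R
      (M ⧸ (Ideal.span (Set.range x) • ⊤ : Submodule R M)) (maximalIdeal R : Set R)) :=
    inferInstance
  have hfin2 : Module.Finite (R ⧸ maximalIdeal R) (Submodule.torsionBySet R
      (M ⧸ (Ideal.span (Set.range x) • ⊤ : Submodule R M)) (maximalIdeal R : Set R)) := by
    obtain ⟨s, hs⟩ := hfin.fg_top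
    refine ⟨⟨s, ?_⟩⟩
    rw [eq_top_iff]
    intro y _
    have hy : y ∈ Submodule.span R (s : Set _) := by rw [hs]; trivial
    induction hy using Submodule.span_induction with
    | mem z hz => exact Submodule.subset_span hz
    | zero => exact zero_mem _
    | add a b _ _ ha hb => exact add_mem (ha trivial) (hb trivial)
    | smul r a _ ha =>
      exact Submodule.smul_mem _ (Ideal.Quotient.mk (maximalIdeal R) r) (ha trivial)
  letI : Field (R ⧸ maximalIdeal R) := Ideal.Quotient.field _
  exact LinearMap.finrank_le_finrank_of_surjective hf
end
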